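/- arXiv:2312.10255 — 2 statements merged into one kernel-verified Lean document; each statement's English description precedes it below -/
import Mathlib

section
/- Let n ≥ 1 be an integer and ψ: ℕ → ℝ⁺ non-increasing with s^{(n+1)/n}·ψ(s) → 0 as s → ∞. Then the set E(ψ) of exactly ψ-approximable vectors in ℝⁿ is non-empty (in fact, uncountable). -/
open Real Filter MeasureTheory

/-- The set `W(ψ)` of `ψ`-approximable points of `ℝⁿ` (sup norm): those `x` admitting
infinitely many rational points `v = p/q ∈ ℚⁿ` with `‖x - p/q‖ < ψ(q)`, where `q` is the
reduced common denominator of `v`. -/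
def Wapprox (n : ℕ) (ψ : ℕ → ℝ) : Set (Fin n → ℝ) :=
  {x | {v : Fin n → ℚ |
      ‖x - fun i => (v i : ℝ)‖ < ψ (Finset.univ.lcm fun i => (v i).den)}.Infinite}

/-- The set `E(ψ) = W(ψ) \ ⋃_{0<c<1} W(cψ)` of exactly `ψ`-approximable points. -/
def Eapprox (n : ℕ) (ψ : ℕ → ℝ) : Set (Fin n → ℝ) :=
  Wapprox n ψ \ ⋃ c ∈ Set.Ioo (0 : ℝ) 1, Wapprox n (fun q => c * ψ q)

/-- The points `w` of `ℝⁿ` such that `t • w` is an integer vector. -/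
def fracPoints (n t : ℕ) : Set (Fin n → ℝ) := {w | ∀ i, ∃ m : ℤ, (t : ℝ) * w i = m}

/-- The simplex lemma in determinant form. -/
lemma det_homogeneous_eq_zero {n : ℕ} (a : Fin n → ℝ) {r T : ℝ} (hr : 0 < r)
    (t : Fin (n + 1) → ℕ) (w : Fin (n + 1) → Fin n → ℝ)
    (hw : ∀ i, w i ∈ fracPoints n (t i)) (hwa : ∀ i, ‖w i - a‖ ≤ r) (ht : ∀ i, (t i : ℝ) ≤ T)
    (hT : ((n + 1).factorial : ℝ) * (T ^ (n + 1) * r ^ n) < 1) :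
    (Matrix.of fun i => (Fin.cons (t i : ℝ) ((t i : ℝ) • w i) : Fin (n + 1) → ℝ)).det = 0 := by
  set A : Matrix (Fin (n + 1)) (Fin (n + 1)) ℝ :=
    Matrix.of fun i => (Fin.cons (t i : ℝ) ((t i : ℝ) • w i) : Fin (n + 1) → ℝ) with hA
  set E : Matrix (Fin (n + 1)) (Fin (n + 1)) ℝ :=
    Matrix.of fun i => (Fin.cons 1 (r⁻¹ • (w i - a)) : Fin (n + 1) → ℝ) with hE
  set s : Fin (n + 1) → ℝ := Fin.cons 1 fun _ => r with hs
  have hdet : A.det = (∏ i, (t i : ℝ)) * (r ^ n * E.det) := by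
    have h1 : (∏ j, s j) = r ^ n := by simp [hs, Fin.prod_univ_succ]
    rw [← h1, ← Matrix.det_mul_row, ← Matrix.det_mul_column, ← Matrix.det_transpose A,
      ← Matrix.det_transpose (Matrix.of _)]
    refine Matrix.det_eq_of_forall_row_eq_smul_add_const (Fin.cons 0 a) 0 (by simp) ?_
    intro i j
    refine Fin.cases ?_ (fun i => ?_) i
    · simp [hA, hE, hs]
    · simp [hA, hE, hs]
      field_simp
      ring
  have hEle : |E.det| ≤ ((n + 1).factorial : ℝ) := by
    have := Matrix.det_le (A := E) (abv := AbsoluteValue.abs) (x := (1 : ℝ)) ?_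
    · simpa using this
    · intro i j
      refine Fin.cases ?_ (fun j => ?_) j
      · simp [hE]
      · have h2 := (norm_le_pi_norm (w i - a) j).trans (hwa i)
        rw [Real.norm_eq_abs] at h2
        simp only [hE, Matrix.of_apply, Fin.cons_succ, Pi.smul_apply, smul_eq_mul,
          AbsoluteValue.abs_apply, abs_mul, abs_inv, abs_of_pos hr]
        rw [inv_mul_le_iff₀ hr, mul_one]
        exact h2
  have hT0 : 0 ≤ T := (Nat.cast_nonneg _).trans (ht 0)
  have hlt : |A.det| < 1 := by
    have hp : |∏ i, (t i : ℝ)| ≤ T ^ (n + 1) := by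
      rw [abs_of_nonneg (Finset.prod_nonneg fun i _ => Nat.cast_nonneg _)]
      calc ∏ i, (t i : ℝ) ≤ ∏ _i : Fin (n + 1), T :=
            Finset.prod_le_prod (fun i _ => Nat.cast_nonneg _) fun i _ => ht i
        _ = T ^ (n + 1) := by simp
    calc |A.det| = |∏ i, (t i : ℝ)| * (r ^ n * |E.det|) := by
          rw [hdet, abs_mul, abs_mul, abs_of_pos (pow_pos hr n)]
      _ ≤ T ^ (n + 1) * (r ^ n * ((n + 1).factorial : ℝ)) := by gcongr
      _ < 1 := by linarith
  obtain ⟨d, hd⟩ : ∃ d : ℤ, A.det = d := by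
    have hAint : ∀ i j, ∃ m : ℤ, A i j = m := by
      intro i j
      refine Fin.cases ⟨t i, by simp [hA]⟩ (fun j => ?_) j
      obtain ⟨m, hm⟩ := hw i j
      exact ⟨m, by simpa [hA] using hm⟩
    choose B hB using hAint
    refine ⟨(Matrix.of B).det, ?_⟩
    have hAB : A = (Matrix.of B).map (Int.castRingHom ℝ) := by ext i j; simp [hB]
    rw [hAB, ← RingHom.mapMatrix_apply, ← RingHom.map_det]
    simp
  rw [hd] at hlt ⊢
  have : |d| < 1 := by exact_mod_cast hlt
  simpa using Int.abs_lt_one_iff.mp this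

/-- The simplex lemma: points of bounded height in a small ball lie in a hyperplane. -/
lemma exists_hyperplane {n : ℕ} (hn : 1 ≤ n) (a : Fin n → ℝ) {r : ℝ} (hr : 0 < r) :
    ∃ (α : Fin n → ℝ) (b : ℝ), α ≠ 0 ∧ ∀ t : ℕ, 0 < t →
      ((n + 1).factorial : ℝ) * ((t : ℝ) ^ (n + 1) * r ^ n) < 1 →
      ∀ w ∈ fracPoints n t, ‖w - a‖ ≤ r → ∑ i, α i * w i = b := by
  set S : Set (Fin (n + 1) → ℝ) := {u | ∃ (t : ℕ) (w : Fin n → ℝ), 0 < t ∧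
      ((n + 1).factorial : ℝ) * ((t : ℝ) ^ (n + 1) * r ^ n) < 1 ∧ w ∈ fracPoints n t ∧
      ‖w - a‖ ≤ r ∧ u = Fin.cons (t : ℝ) ((t : ℝ) • w)} with hS
  have hspan : Submodule.span ℝ S < ⊤ := by
    rw [lt_top_iff_ne_top]
    intro htop
    let b := Module.Basis.ofSpan htop.ge
    have hb : ∀ i, b i ∈ S := fun i => Module.Basis.ofSpan_subset htop.ge ⟨i, rfl⟩
    let e := b.indexEquiv (Pi.basisFun ℝ (Fin (n + 1)))
    let b' := b.reindex e
    have hb' : ∀ i, b' i ∈ S := fun i => by simpa [b'] using hb (e.symm i)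
    choose t w ht hT hw hwa hu using hb'
    obtain ⟨i₀, hi₀⟩ := Finite.exists_max t
    have h0 := det_homogeneous_eq_zero a hr t w hw hwa
      (fun i => (by exact_mod_cast hi₀ i : (t i : ℝ) ≤ t i₀)) (hT i₀)
    have hli : LinearIndependent ℝ (Matrix.of fun i =>
        (Fin.cons (t i : ℝ) ((t i : ℝ) • w i) : Fin (n + 1) → ℝ)).row := by
      have : (Matrix.of fun i =>
        (Fin.cons (t i : ℝ) ((t i : ℝ) • w i) : Fin (n + 1) → ℝ)).row = b' := by
        funext i; rw [hu i]; rfl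
      rw [this]; exact b'.linearIndependent
    rw [Matrix.linearIndependent_rows_iff_isUnit, Matrix.isUnit_iff_isUnit_det, h0] at hli
    simp at hli
  obtain ⟨f, hf0, hf⟩ := Submodule.exists_le_ker_of_lt_top _ hspan
  set c : Fin (n + 1) → ℝ := fun i => f (Pi.single i 1) with hc
  have hfc : ∀ u, f u = ∑ i, c i * u i := by
    intro u
    rw [LinearMap.pi_apply_eq_sum_univ f u]
    refine Finset.sum_congr rfl fun i _ => ?_
    rw [smul_eq_mul, mul_comm]
    congr 2
    funext j
    simp [Pi.single_apply, eq_comm]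
  have key : ∀ t : ℕ, 0 < t →
      ((n + 1).factorial : ℝ) * ((t : ℝ) ^ (n + 1) * r ^ n) < 1 →
      ∀ w ∈ fracPoints n t, ‖w - a‖ ≤ r → ∑ i, c (Fin.succ i) * w i = - c 0 := by
    intro t ht hT w hw hwa
    have h1 := hf (Submodule.subset_span ⟨t, w, ht, hT, hw, hwa, rfl⟩)
    rw [LinearMap.mem_ker, hfc, Fin.sum_univ_succ] at h1
    have ht' : (t : ℝ) ≠ 0 := by positivity
    apply mul_left_cancel₀ ht'
    rw [Finset.mul_sum]
    simp only [Fin.cons_zero, Fin.cons_succ, Pi.smul_apply, smul_eq_mul] at h1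
    have h2 : ∑ i, (t : ℝ) * (c (Fin.succ i) * w i) = ∑ i, c (Fin.succ i) * (t * w i) :=
      Finset.sum_congr rfl fun i _ => by ring
    rw [h2]; linarith
  by_cases h0 : (fun i => c (Fin.succ i)) = 0
  · refine ⟨fun _ => 1, 0, fun h => one_ne_zero (congrFun h ⟨0, hn⟩),
      fun t ht hT w hw hwa => (hf0 ?_).elim⟩
    have hcs : ∀ i, c (Fin.succ i) = 0 := fun i => congrFun h0 i
    have hc0 : c 0 = 0 := by simpa [hcs] using key t ht hT w hw hwa
    refine LinearMap.ext fun u => ?_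
    simp [hfc, Fin.sum_univ_succ, hcs, hc0]
  · exact ⟨_, _, h0, key⟩

/-- Any ball contains a smaller ball of comparable radius lying far from a given hyperplane. -/
lemma exists_closedBall_far_from_hyperplane {n : ℕ} (hn : 1 ≤ n) (a : Fin n → ℝ) {r : ℝ}
    (hr : 0 < r) (α : Fin n → ℝ) (b : ℝ) (hα : α ≠ 0) :
    ∃ a', Metric.closedBall a' (r / (3 * n)) ⊆ Metric.closedBall a r ∧
      ∀ x ∈ Metric.closedBall a' (r / (3 * n)), ∀ w : Fin n → ℝ, ∑ i, α i * w i = b →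
        r / (3 * n) ≤ ‖x - w‖ := by
  have : Nonempty (Fin n) := ⟨⟨0, hn⟩⟩
  obtain ⟨k, hk⟩ := Finite.exists_max fun i => |α i|
  have hn' : (1 : ℝ) ≤ n := by exact_mod_cast hn
  have hkpos : 0 < |α k| := by
    obtain ⟨i, hi⟩ := Function.ne_iff.mp hα
    exact (abs_pos.mpr hi).trans_le (hk i)
  have hlip : ∀ u : Fin n → ℝ, |∑ i, α i * u i| ≤ n * |α k| * ‖u‖ := by
    intro u
    calc |∑ i, α i * u i| ≤ ∑ i, |α i * u i| := Finset.abs_sum_le_sum_abs _ _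
      _ ≤ ∑ _i : Fin n, |α k| * ‖u‖ := by
          refine Finset.sum_le_sum fun i _ => ?_
          rw [abs_mul]
          exact mul_le_mul (hk i) (norm_le_pi_norm u i) (abs_nonneg _) (abs_nonneg _)
      _ = n * |α k| * ‖u‖ := by simp [mul_assoc]
  obtain ⟨s, hs, hfar⟩ : ∃ s : ℝ, |s| = 2 * r / 3 ∧
      2 * r / 3 * |α k| ≤ |∑ i, α i * (a + Pi.single k s : Fin n → ℝ) i - b| := by
    have hval : ∀ s : ℝ, ∑ i, α i * (a + Pi.single k s : Fin n → ℝ) i - b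
        = (∑ i, α i * a i - b) + α k * s := by
      intro s
      simp [mul_add, Finset.sum_add_distrib, Pi.single_apply]
      ring
    have habs : |2 * r / 3| = 2 * r / 3 := abs_of_pos (by positivity)
    by_cases h : 0 ≤ (∑ i, α i * a i - b) * α k
    · refine ⟨2 * r / 3, habs, ?_⟩
      rw [hval, ← habs, ← abs_mul, habs, ← sq_le_sq]
      nlinarith [sq_nonneg (∑ i, α i * a i - b)]
    · refine ⟨-(2 * r / 3), by rw [abs_neg, habs], ?_⟩
      rw [hval, ← habs, ← abs_mul, habs, ← sq_le_sq]
      nlinarith [sq_nonneg (∑ i, α i * a i - b)]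
  have hρ : r / (3 * n) ≤ r / 3 := by
    apply div_le_div_of_nonneg_left hr.le (by norm_num); linarith
  refine ⟨a + Pi.single k s, ?_, ?_⟩
  · refine Metric.closedBall_subset_closedBall' ?_
    have : dist (a + Pi.single k s) a = 2 * r / 3 := by
      rw [dist_eq_norm, add_sub_cancel_left, Pi.norm_single, Real.norm_eq_abs, hs]
    rw [this]; linarith
  · intro x hx w hw
    rw [Metric.mem_closedBall, dist_eq_norm] at hx
    have h1 := hlip (a + Pi.single k s - w)
    have h2 : ∑ i, α i * (a + Pi.single k s - w : Fin n → ℝ) i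
        = ∑ i, α i * (a + Pi.single k s : Fin n → ℝ) i - b := by
      rw [← hw, ← Finset.sum_sub_distrib]
      exact Finset.sum_congr rfl fun i _ => by rw [Pi.sub_apply]; ring
    rw [h2] at h1
    have h3 : ‖a + Pi.single k s - w‖ ≤ r / (3 * n) + ‖x - w‖ := by
      have := norm_sub_le (x - w) (x - (a + Pi.single k s))
      have e : x - w - (x - (a + Pi.single k s)) = a + Pi.single k s - w := by abel
      rw [e] at this; linarith
    have h4 : 2 * r / 3 * |α k| ≤ n * |α k| * (r / (3 * n) + ‖x - w‖) :=
      hfar.trans (h1.trans (by gcongr))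
    have h5 : 2 * r / 3 ≤ n * (r / (3 * n) + ‖x - w‖) := by
      have : 2 * r / 3 * |α k| ≤ n * (r / (3 * n) + ‖x - w‖) * |α k| := by linarith
      exact le_of_mul_le_mul_right this hkpos
    have h6 : (n : ℝ) * (r / (3 * n)) = r / 3 := by field_simp
    have h7 : (n : ℝ) * (r / (3 * n)) ≤ n * ‖x - w‖ := by rw [mul_add] at h5; linarith
    exact le_of_mul_le_mul_left h7 (by linarith)

/-- One move of the Cantor-type construction of badly approximable points. -/
lemma exists_closedBall_far_from_fracPoints {n : ℕ} (hn : 1 ≤ n) (a : Fin n → ℝ) {r : ℝ}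
    (hr : 0 < r) :
    ∃ a', Metric.closedBall a' (r / (3 * n)) ⊆ Metric.closedBall a r ∧
      ∀ x ∈ Metric.closedBall a' (r / (3 * n)), ∀ t : ℕ, 0 < t →
        ((n + 1).factorial : ℝ) * 2 ^ n * ((t : ℝ) ^ (n + 1) * r ^ n) < 1 →
        ∀ w ∈ fracPoints n t, r / (3 * n) ≤ ‖x - w‖ := by
  obtain ⟨α, b, hα, h⟩ := exists_hyperplane hn a (r := 2 * r) (by positivity)
  obtain ⟨a', hsub, hfar⟩ := exists_closedBall_far_from_hyperplane hn a hr α b hα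
  refine ⟨a', hsub, fun x hx t ht hT w hw => ?_⟩
  by_cases hwa : ‖w - a‖ ≤ 2 * r
  · exact hfar x hx w (h t ht (by rw [mul_pow]; linarith) w hw hwa)
  · have hx' := hsub hx
    rw [Metric.mem_closedBall, dist_eq_norm] at hx'
    have h1 := norm_sub_le (x - a) (x - w)
    rw [show x - a - (x - w) = w - a by abel] at h1
    have hn' : (1 : ℝ) ≤ n := by exact_mod_cast hn
    have hρ : r / (3 * n) ≤ r := div_le_self hr.le (by linarith)
    linarith

/-- Every ball contains points that are badly approximable, with uniform constants. -/
lemma exists_badly_approximable {n : ℕ} (hn : 1 ≤ n) :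
    ∃ d : ℝ, 0 < d ∧ d ≤ 1 ∧ ∀ (a : Fin n → ℝ) (ρ : ℝ), 0 < ρ →
      ∃ y ∈ Metric.closedBall a ρ, ∀ t : ℕ, 0 < t → ∀ w ∈ fracPoints n t,
        d * ρ ≤ ‖y - w‖ ∨ d ^ n ≤ (t : ℝ) ^ (n + 1) * ‖y - w‖ ^ n := by
  have hn' : (1 : ℝ) ≤ n := by exact_mod_cast hn
  set β : ℝ := 1 / (3 * n) with hβ
  have hβ0 : 0 < β := by positivity
  have hβ1 : β < 1 := by rw [hβ, div_lt_one (by positivity)]; linarith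
  set A : ℝ := ((n + 1).factorial : ℝ) * 2 ^ n with hA
  have hA0 : 0 < A := by positivity
  have hA1 : 1 ≤ A := by
    have h1 : (1 : ℝ) ≤ ((n + 1).factorial : ℝ) := by
      exact_mod_cast Nat.succ_le_of_lt (Nat.factorial_pos _)
    have h2 : (1 : ℝ) ≤ 2 ^ n := one_le_pow₀ (by norm_num)
    exact one_le_mul_of_one_le_of_one_le h1 h2
  refine ⟨β ^ 2 / A, by positivity, ?_, fun a ρ hρ => ?_⟩
  · rw [div_le_one hA0]; exact (pow_le_one₀ hβ0.le hβ1.le).trans hA1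
  have hstep : ∀ (a : Fin n → ℝ) (j : ℕ), ∃ a' : Fin n → ℝ,
      Metric.closedBall a' (β ^ (j + 1) * ρ) ⊆ Metric.closedBall a (β ^ j * ρ) ∧
      ∀ x ∈ Metric.closedBall a' (β ^ (j + 1) * ρ), ∀ t : ℕ, 0 < t →
        A * ((t : ℝ) ^ (n + 1) * (β ^ j * ρ) ^ n) < 1 →
        ∀ w ∈ fracPoints n t, β ^ (j + 1) * ρ ≤ ‖x - w‖ := by
    intro a j
    have := exists_closedBall_far_from_fracPoints hn a (r := β ^ j * ρ) (by positivity)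
    rwa [show β ^ j * ρ / (3 * n) = β ^ (j + 1) * ρ by
      rw [pow_succ, show ∀ u : ℝ, u / (3 * n) = u * β by intro u; rw [hβ]; ring]; ring] at this
  choose g hg1 hg2 using hstep
  let c : ℕ → (Fin n → ℝ) := fun j => Nat.rec a (fun j x => g x j) j
  have hc : ∀ j, c (j + 1) = g (c j) j := fun j => rfl
  obtain ⟨y, hy⟩ := IsCompact.nonempty_iInter_of_sequence_nonempty_isCompact_isClosed
    (fun j => Metric.closedBall (c j) (β ^ j * ρ)) (fun j => by rw [hc]; exact hg1 _ _)
    (fun j => ⟨c j, Metric.mem_closedBall_self (by positivity)⟩)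
    (isCompact_closedBall _ _) (fun j => Metric.isClosed_closedBall)
  rw [Set.mem_iInter] at hy
  refine ⟨y, by simpa [c] using hy 0, fun t ht w hw => ?_⟩
  have hex : ∃ j : ℕ, A * ((t : ℝ) ^ (n + 1) * (β ^ j * ρ) ^ n) < 1 := by
    have h1 : Tendsto (fun j : ℕ => A * ((t : ℝ) ^ (n + 1) * (β ^ j * ρ) ^ n)) atTop
        (nhds (A * ((t : ℝ) ^ (n + 1) * (0 * ρ) ^ n))) :=
      ((((tendsto_pow_atTop_nhds_zero_of_lt_one hβ0.le hβ1).mul_const ρ).pow n).const_mul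
        _).const_mul _
    rw [zero_mul, zero_pow (by omega), mul_zero, mul_zero] at h1
    exact (h1.eventually (gt_mem_nhds one_pos)).exists
  classical
  have hmin := Nat.find_spec hex
  have hfar : ∀ j, A * ((t : ℝ) ^ (n + 1) * (β ^ j * ρ) ^ n) < 1 →
      β ^ (j + 1) * ρ ≤ ‖y - w‖ := fun j hj =>
    hg2 (c j) j y (by rw [← hc]; exact hy (j + 1)) t ht hj w hw
  rcases hj : Nat.find hex with _ | j
  · left
    rw [hj] at hmin
    have h1 := hfar 0 hmin
    refine le_trans ?_ h1
    rw [zero_add, pow_one]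
    gcongr
    calc β ^ 2 / A ≤ β ^ 2 := div_le_self (by positivity) hA1
      _ ≤ β := by nlinarith
  · right
    rw [hj] at hmin
    have h1 := hfar _ hmin
    have h2 : 1 ≤ A * ((t : ℝ) ^ (n + 1) * (β ^ j * ρ) ^ n) :=
      not_lt.mp (Nat.find_min hex (by omega : j < Nat.find hex))
    have h3 : (β ^ (j + 1 + 1) * ρ) ^ n ≤ ‖y - w‖ ^ n := by gcongr
    calc (β ^ 2 / A) ^ n = (β ^ 2) ^ n / A ^ n := div_pow _ _ _
      _ ≤ (β ^ 2) ^ n / A := by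
          gcongr
          exact le_self_pow₀ hA1 (by omega)
      _ ≤ (β ^ 2) ^ n / A * (A * ((t : ℝ) ^ (n + 1) * (β ^ j * ρ) ^ n)) :=
          le_mul_of_one_le_right (by positivity) h2
      _ = (t : ℝ) ^ (n + 1) * (β ^ (j + 1 + 1) * ρ) ^ n := by
          rw [show β ^ (j + 1 + 1) * ρ = β ^ 2 * (β ^ j * ρ) by ring, mul_pow (β ^ 2)]
          field_simp
      _ ≤ (t : ℝ) ^ (n + 1) * ‖y - w‖ ^ n := by gcongr

/-- Dirichlet's simultaneous approximation theorem. -/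
lemma exists_fracPoints_near {n : ℕ} (y : Fin n → ℝ) {N : ℕ} (hN : 0 < N) :
    ∃ t : ℕ, 0 < t ∧ t ≤ N ^ n ∧ ∃ w ∈ fracPoints n t, ‖y - w‖ < 1 / (t * N) := by
  have hN' : (0 : ℝ) < N := by exact_mod_cast hN
  have hbox : ∀ (k : ℕ) (i : Fin n), ⌊(N : ℝ) * Int.fract (k * y i)⌋₊ < N := by
    intro k i
    rw [Nat.floor_lt (mul_nonneg hN'.le (Int.fract_nonneg _))]
    nlinarith [Int.fract_lt_one (k * y i)]
  let f : Fin (N ^ n + 1) → (Fin n → Fin N) := fun k i => ⟨_, hbox k i⟩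
  obtain ⟨k, l, hkl, hf⟩ : ∃ k l, k < l ∧ f k = f l := by
    obtain ⟨k, l, hne, h⟩ := Fintype.exists_ne_map_eq_of_card_lt f (by simp)
    rcases lt_or_gt_of_ne hne with h' | h'
    · exact ⟨k, l, h', h⟩
    · exact ⟨l, k, h', h.symm⟩
  have hkl' : (k : ℕ) < l := hkl
  have ht : ((l - k : ℕ) : ℝ) = (l : ℝ) - k := by push_cast [Nat.cast_sub hkl'.le]; rfl
  have htpos : (0 : ℝ) < ((l - k : ℕ) : ℝ) := by exact_mod_cast Nat.sub_pos_of_lt hkl'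
  refine ⟨l - k, Nat.sub_pos_of_lt hkl', by omega,
    fun i => ((⌊(l : ℝ) * y i⌋ - ⌊(k : ℝ) * y i⌋ : ℤ) : ℝ) / ((l - k : ℕ) : ℝ),
    fun i => ⟨_, mul_div_cancel₀ _ htpos.ne'⟩, ?_⟩
  rw [pi_norm_lt_iff (by positivity)]
  intro i
  have h1 : ⌊(N : ℝ) * Int.fract (l * y i)⌋ = ⌊(N : ℝ) * Int.fract (k * y i)⌋ := by
    have := congrArg Fin.val (congrFun hf i)
    simp only [f] at this
    rw [← Int.natCast_floor_eq_floor (mul_nonneg hN'.le (Int.fract_nonneg _)),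
      ← Int.natCast_floor_eq_floor (mul_nonneg hN'.le (Int.fract_nonneg _)), this]
  have h2 := Int.abs_sub_lt_one_of_floor_eq_floor h1
  rw [← mul_sub, abs_mul, abs_of_pos hN'] at h2
  have h3 : y i - ((⌊(l : ℝ) * y i⌋ - ⌊(k : ℝ) * y i⌋ : ℤ) : ℝ) / ((l - k : ℕ) : ℝ)
      = (Int.fract (l * y i) - Int.fract (k * y i)) / ((l - k : ℕ) : ℝ) := by
    rw [Int.fract, Int.fract]
    field_simp
    rw [ht]; push_cast; ring
  rw [Pi.sub_apply, h3, Real.norm_eq_abs, abs_div, abs_of_pos htpos,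
    div_lt_div_iff₀ htpos (by positivity)]
  nlinarith

/-- The reduced common denominator of a rational point. -/
def commonDen {n : ℕ} (v : Fin n → ℚ) : ℕ := Finset.univ.lcm fun i => (v i).den

/-- A rational point seen as a point of `ℝⁿ`. -/
def ratPoint {n : ℕ} (v : Fin n → ℚ) : Fin n → ℝ := fun i => (v i : ℝ)

lemma ratPoint_injective {n : ℕ} : Function.Injective (ratPoint (n := n)) := fun v w h => by
  funext i
  have h1 : (v i : ℝ) = w i := congrFun h i
  exact_mod_cast h1

lemma commonDen_pos {n : ℕ} (v : Fin n → ℚ) : 0 < commonDen v :=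
  Nat.pos_of_ne_zero fun h => by
    obtain ⟨i, -, hi⟩ := Finset.lcm_eq_zero_iff.mp h
    exact (v i).den_ne_zero hi

lemma ratPoint_mem_fracPoints {n : ℕ} (v : Fin n → ℚ) :
    ratPoint v ∈ fracPoints n (commonDen v) := by
  intro i
  obtain ⟨c, hc⟩ : (v i).den ∣ commonDen v := Finset.dvd_lcm (Finset.mem_univ i)
  refine ⟨c * (v i).num, ?_⟩
  have h : ((v i).den : ℚ) * v i = (v i).num := Rat.den_mul_eq_num _
  have h' : ((v i).den : ℝ) * (v i : ℝ) = (v i).num := by exact_mod_cast h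
  rw [hc, ratPoint]
  push_cast
  rw [← h']; ring

lemma exists_ratPoint_of_mem_fracPoints {n t : ℕ} (ht : 0 < t) {w : Fin n → ℝ}
    (hw : w ∈ fracPoints n t) : ∃ v : Fin n → ℚ, ratPoint v = w ∧ commonDen v ≤ t := by
  choose m hm using hw
  refine ⟨fun i => (m i : ℚ) / (t : ℤ), ?_, Nat.le_of_dvd ht (Finset.lcm_dvd fun i _ => ?_)⟩
  · funext i
    have : (t : ℝ) ≠ 0 := by positivity
    simp only [ratPoint]
    push_cast
    rw [← hm i]
    field_simp
  · change ((m i : ℚ) / ((t : ℤ) : ℚ)).den ∣ t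
    rw [← Rat.divInt_eq_div]
    exact_mod_cast Rat.den_dvd (m i) t

/-- Rational points whose denominator is comparable to `N ^ n` and which are as far as possible
from the other rational points. -/
structure IsBalanced {n : ℕ} (d κ : ℝ) (v : Fin n → ℚ) (N : ℕ) : Prop where
  pos : 0 < N
  le_den : (d * N) ^ n ≤ commonDen v
  den_le : (commonDen v : ℝ) ≤ (N : ℝ) ^ n
  far : ∀ t : ℕ, 0 < t → ∀ w ∈ fracPoints n t, w ≠ ratPoint v →
    κ / (N * t) ≤ ‖ratPoint v - w‖

/-- A rational point that is very close to a badly approximable point is far from the other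
rational points. -/
lemma far_of_near_badly_approximable {n : ℕ} {d ρ : ℝ} (hd : 0 < d) (hd1 : d ≤ 1)
    {M N q : ℕ} (hM : 2 / d < M) (hN : 1 / ρ < N) (hρ : 0 < ρ) (hq : 0 < q)
    (hqN : (q : ℝ) ≤ (N : ℝ) ^ n) {y v : Fin n → ℝ}
    (hy : ∀ t : ℕ, 0 < t → ∀ w ∈ fracPoints n t,
        d * ρ ≤ ‖y - w‖ ∨ d ^ n ≤ (t : ℝ) ^ (n + 1) * ‖y - w‖ ^ n)
    (hn : 1 ≤ n)
    (hv : v ∈ fracPoints n q) (hvy : ‖y - v‖ < 1 / (q * N)) :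
    ∀ t : ℕ, 0 < t → ∀ w ∈ fracPoints n t, w ≠ v → (1 / (M : ℝ) ^ 2) / (N * t) ≤ ‖v - w‖ := by
  intro t ht w hw hwv
  by_contra! hlt
  have hNpos : (0 : ℝ) < N := (by positivity : (0 : ℝ) < 1 / ρ).trans hN
  have hMpos : (0 : ℝ) < M := (by positivity : (0 : ℝ) < 2 / d).trans hM
  have hM2 : (2 : ℝ) < M * d := by rwa [div_lt_iff₀ hd] at hM
  have hM1 : (1 : ℝ) ≤ M := by nlinarith
  have hN1 : (1 : ℝ) ≤ N := by
    have : 0 < N := by exact_mod_cast hNpos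
    exact_mod_cast this
  have hq' : (0 : ℝ) < q := by exact_mod_cast hq
  have ht' : (0 : ℝ) < t := by exact_mod_cast ht
  obtain ⟨j, k, hk0, hkM, hjk⟩ := Real.exists_int_int_abs_mul_sub_le ((t : ℝ) / q)
    (by exact_mod_cast hMpos : 0 < M)
  have hk0' : (0 : ℝ) < k := by exact_mod_cast hk0
  have hkM' : (k : ℝ) ≤ M := by exact_mod_cast hkM
  choose p hp using hw
  choose r hr using hv
  set s : ℤ := k * t - j * q with hs
  have hscast : (s : ℝ) = k * t - j * q := by rw [hs]; push_cast; ring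
  have hsq : |(s : ℝ)| ≤ q / M := by
    have h1 : (s : ℝ) = q * (k * ((t : ℝ) / q) - j) := by rw [hscast]; field_simp
    rw [h1, abs_mul, abs_of_pos hq', div_eq_mul_one_div (q : ℝ) M]
    gcongr
    refine hjk.trans ?_
    gcongr
    linarith
  have hwv' : (k * t : ℝ) * ‖v - w‖ < 1 / (M * N) := by
    calc (k * t : ℝ) * ‖v - w‖ < (k * t : ℝ) * ((1 / (M : ℝ) ^ 2) / (N * t)) := by gcongr
      _ = k * (1 / (M ^ 2 * N)) := by field_simp
      _ ≤ M * (1 / (M ^ 2 * N)) := by gcongr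
      _ = 1 / (M * N) := by field_simp
  by_cases hs0 : s = 0
  · apply hwv
    have hkt : (k : ℝ) * t = j * q := by
      have := hscast; rw [hs0] at this; push_cast at this; linarith
    funext i
    have h1 : (k * t : ℝ) * (v i - w i) = ((j * r i - k * p i : ℤ) : ℝ) := by
      push_cast
      rw [← hp, ← hr, mul_sub]
      nth_rewrite 1 [hkt]
      ring
    have h2 : |((j * r i - k * p i : ℤ) : ℝ)| < 1 := by
      rw [← h1, abs_mul, abs_of_pos (by positivity : (0 : ℝ) < k * t)]
      calc (k * t : ℝ) * |v i - w i| ≤ k * t * ‖v - w‖ := by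
            gcongr
            exact norm_le_pi_norm (v - w) i
        _ < 1 / (M * N) := hwv'
        _ ≤ 1 := by
            rw [div_le_one (by positivity)]
            exact one_le_mul_of_one_le_of_one_le hM1 hN1
    have h3 : j * r i - k * p i = 0 := by
      rw [← Int.abs_lt_one_iff]; exact_mod_cast h2
    rw [h3, Int.cast_zero] at h1
    have h4 : v i - w i = 0 := (mul_eq_zero.mp h1).resolve_left (by positivity)
    linarith
  · have hsR : (s : ℝ) ≠ 0 := by exact_mod_cast hs0
    have hspos : 0 < |(s : ℝ)| := abs_pos.mpr hsR
    have hs1 : 1 ≤ |(s : ℝ)| := by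
      have := Int.one_le_abs hs0
      exact_mod_cast this
    have hnat : ((s.natAbs : ℕ) : ℝ) = |(s : ℝ)| := by
      rw [Nat.cast_natAbs, Int.cast_abs]
    set u : Fin n → ℝ := fun i => ((k * p i - j * r i : ℤ) : ℝ) / s with hu
    have humem : u ∈ fracPoints n s.natAbs := by
      intro i
      rw [hnat]
      rcases abs_choice (s : ℝ) with h | h
      · exact ⟨k * p i - j * r i, by rw [h, hu]; field_simp⟩
      · exact ⟨-(k * p i - j * r i), by
          rw [h, hu]; simp only [Int.cast_neg]; field_simp⟩
    have hvu : ‖v - u‖ ≤ 1 / (M * N * |(s : ℝ)|) := by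
      have h1 : v - u = (k * t / s : ℝ) • (v - w) := by
        funext i
        simp only [hu, Pi.sub_apply, Pi.smul_apply, smul_eq_mul]
        push_cast
        rw [← hp, ← hr]
        field_simp
        rw [hscast]; ring
      rw [h1, norm_smul, Real.norm_eq_abs, abs_div, abs_of_pos (by positivity : (0 : ℝ) < k * t),
        div_mul_eq_mul_div, ← div_div]
      gcongr
    have hyv : ‖y - v‖ ≤ 1 / (M * N * |(s : ℝ)|) := by
      refine hvy.le.trans ?_
      gcongr 1 / ?_
      rw [le_div_iff₀ hMpos] at hsq
      nlinarith
    have hyu : ‖y - u‖ ≤ 2 / (M * N * |(s : ℝ)|) := by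
      have := norm_add_le (y - v) (v - u)
      rw [sub_add_sub_cancel] at this
      refine this.trans ((add_le_add hyv hvu).trans (le_of_eq (by ring)))
    rcases hy s.natAbs (Int.natAbs_pos.mpr hs0) u humem with h | h
    · have h1 : d * ρ ≤ 2 / (M * N) := by
        refine h.trans (hyu.trans ?_)
        exact div_le_div_of_nonneg_left (by positivity) (by positivity)
          (le_mul_of_one_le_right (by positivity) hs1)
      rw [le_div_iff₀ (by positivity)] at h1
      rw [div_lt_iff₀ hρ] at hN
      nlinarith [mul_pos hMpos hd]
    · rw [hnat] at h
      have h1 : |(s : ℝ)| ^ (n + 1) * ‖y - u‖ ^ n ≤ (2 / M) ^ n := by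
        calc |(s : ℝ)| ^ (n + 1) * ‖y - u‖ ^ n
            ≤ |(s : ℝ)| ^ (n + 1) * (2 / (M * N * |(s : ℝ)|)) ^ n := by gcongr
          _ = (2 / M) ^ n * (|(s : ℝ)| / N ^ n) := by
              simp only [div_pow, mul_pow, pow_succ]; field_simp
          _ ≤ (2 / M) ^ n * 1 := by
              gcongr
              rw [div_le_one (by positivity)]
              exact hsq.trans ((div_le_self hq'.le hM1).trans hqN)
          _ = (2 / M) ^ n := mul_one _
      have h2 : (2 / M : ℝ) ^ n < d ^ n := by
        apply pow_lt_pow_left₀ _ (by positivity) (by omega)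
        rw [div_lt_iff₀ hMpos]; linarith
      linarith

/-- Every ball contains a point that is badly approximable with uniform constants, and that is
approximated by balanced rational points. -/
lemma exists_badly_approximable_balanced {n : ℕ} (hn : 1 ≤ n) :
    ∃ d κ : ℝ, 0 < d ∧ d ≤ 1 ∧ 0 < κ ∧ κ ≤ 1 ∧ ∀ (a : Fin n → ℝ) (ρ : ℝ), 0 < ρ →
      ∃ y ∈ Metric.closedBall a ρ, (∀ t : ℕ, 0 < t → ∀ w ∈ fracPoints n t,
        d * ρ ≤ ‖y - w‖ ∨ d ^ n ≤ (t : ℝ) ^ (n + 1) * ‖y - w‖ ^ n) ∧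
        ∀ L : ℕ, ∃ (v : Fin n → ℚ) (N : ℕ), IsBalanced d κ v N ∧ L ≤ commonDen v ∧
          ‖y - ratPoint v‖ < 1 / (commonDen v * N) := by
  obtain ⟨d, hd, hd1, h⟩ := exists_badly_approximable hn
  obtain ⟨M, hM⟩ := exists_nat_gt (2 / d)
  have hM1 : (1 : ℝ) ≤ M := by
    rw [div_lt_iff₀ hd] at hM
    nlinarith [(Nat.cast_nonneg M : (0 : ℝ) ≤ M)]
  refine ⟨d, 1 / (M : ℝ) ^ 2, hd, hd1, by positivity, ?_, fun a ρ hρ => ?_⟩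
  · rw [div_le_one (by positivity)]; exact one_le_pow₀ hM1
  obtain ⟨y, hya, hy⟩ := h a ρ hρ
  refine ⟨y, hya, hy, fun L => ?_⟩
  obtain ⟨N, hN⟩ := exists_nat_gt (max (1 / (d * ρ)) ((L + 1) / d))
  have hN1 := (le_max_left _ _).trans_lt hN
  have hN2 := (le_max_right _ _).trans_lt hN
  have hNpos : (0 : ℝ) < N := (by positivity : 0 < 1 / (d * ρ)).trans hN1
  obtain ⟨t, ht, htN, w, hw, hyw⟩ := exists_fracPoints_near y (by exact_mod_cast hNpos : 0 < N)
  obtain ⟨v, rfl, hvt⟩ := exists_ratPoint_of_mem_fracPoints ht hw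
  have hq := commonDen_pos v
  have hq' : (0 : ℝ) < commonDen v := by exact_mod_cast hq
  have hvt' : (commonDen v : ℝ) ≤ t := by exact_mod_cast hvt
  have hyv : ‖y - ratPoint v‖ < 1 / (commonDen v * N) := by
    refine hyw.trans_le ?_
    gcongr
  have hqN : (commonDen v : ℝ) ≤ (N : ℝ) ^ n := hvt'.trans (by exact_mod_cast htN)
  have hle : (d * N) ^ n ≤ commonDen v := by
    rcases hy _ hq _ (ratPoint_mem_fracPoints v) with h1 | h1
    · have h2 := h1.trans_lt hyv
      rw [lt_div_iff₀ (by positivity)] at h2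
      rw [div_lt_iff₀ (by positivity)] at hN1
      have : (1 : ℝ) ≤ commonDen v := by exact_mod_cast hq
      nlinarith [mul_pos hd hρ]
    · have h2 : d ^ n ≤ (commonDen v : ℝ) ^ (n + 1) * (1 / (commonDen v * N)) ^ n :=
        h1.trans (by gcongr)
      rw [show (commonDen v : ℝ) ^ (n + 1) * (1 / (commonDen v * N)) ^ n
        = commonDen v / (N : ℝ) ^ n by
          simp only [div_pow, mul_pow, pow_succ, one_pow]; field_simp, le_div_iff₀ (by positivity)] at h2
      rwa [mul_pow]
  refine ⟨v, N, ⟨by exact_mod_cast hNpos, hle, hqN, ?_⟩, ?_, hyv⟩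
  · refine far_of_near_badly_approximable hd hd1 hM ?_ hρ hq hqN hy hn
      (ratPoint_mem_fracPoints v) hyv
    refine lt_of_le_of_lt ?_ hN1
    gcongr
    nlinarith
  · rw [div_lt_iff₀ hd] at hN2
    have h1 : (1 : ℝ) ≤ d * N := by linarith [(Nat.cast_nonneg L : (0 : ℝ) ≤ L)]
    have h2 : (L : ℝ) ≤ commonDen v :=
      (by linarith : (L : ℝ) ≤ d * N).trans ((le_self_pow₀ h1 (by omega)).trans hle)
    exact_mod_cast h2

/-- A spherical shell contains a ball of comparable radius avoiding a given point. -/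
lemma exists_closedBall_in_shell {n : ℕ} (hn : 1 ≤ n) (v z : Fin n → ℝ) {s ε : ℝ} (hs : 0 < s)
    (hε : 0 < ε) (hε1 : ε < 1) :
    ∃ a, ∀ x ∈ Metric.closedBall a (ε * s / 4),
      x ≠ z ∧ (1 - ε) * s ≤ ‖x - v‖ ∧ ‖x - v‖ < s := by
  have hεs : ε * s < s := by nlinarith
  have hεs0 : 0 < ε * s := by positivity
  set e : (Fin n → ℝ) := Pi.single ⟨0, hn⟩ ((1 - ε / 2) * s) with he
  have hnorm : ‖e‖ = (1 - ε / 2) * s := by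
    rw [he, Pi.norm_single, Real.norm_eq_abs, abs_of_pos]
    nlinarith
  have main : ∀ a : Fin n → ℝ, ‖a - v‖ = (1 - ε / 2) * s →
      ∀ x ∈ Metric.closedBall a (ε * s / 4), (1 - ε) * s ≤ ‖x - v‖ ∧ ‖x - v‖ < s := by
    intro a ha x hx
    rw [Metric.mem_closedBall, dist_eq_norm] at hx
    have h1 := norm_add_le (x - a) (a - v)
    have h2 := norm_sub_le (x - v) (x - a)
    rw [sub_add_sub_cancel] at h1
    rw [show x - v - (x - a) = a - v by abel] at h2
    constructor <;> nlinarith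
  by_cases hz : z ∈ Metric.closedBall (v + e) (ε * s / 4)
  · refine ⟨v - e, fun x hx => ⟨?_, main _ (by rw [sub_sub_cancel_left, norm_neg, hnorm]) x hx⟩⟩
    rintro rfl
    rw [Metric.mem_closedBall, dist_eq_norm] at hz hx
    have h1 := norm_sub_le (x - (v - e)) (x - (v + e))
    rw [show x - (v - e) - (x - (v + e)) = (2 : ℝ) • e by rw [two_smul]; abel, norm_smul, hnorm]
      at h1
    norm_num at h1
    nlinarith
  · refine ⟨v + e, fun x hx => ⟨?_, main _ (by rw [add_sub_cancel_left, hnorm]) x hx⟩⟩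
    rintro rfl
    exact hz hx

/-- Points close to a balanced rational point avoid the rational points of moderate height. -/
lemma IsBalanced.le_norm_sub {n : ℕ} {ψ : ℕ → ℝ} {d κ : ℝ} {v : Fin n → ℚ} {N : ℕ}
    (hv : IsBalanced d κ v N) {x : Fin n → ℝ}
    {s : ℝ} (hx : ‖x - ratPoint v‖ ≤ s) {t : ℕ} (ht : 0 < t)
    (hκ : N * t * (s + ψ t) ≤ κ) {w : Fin n → ℝ} (hw : w ∈ fracPoints n t)
    (hwv : w ≠ ratPoint v) : ψ t ≤ ‖x - w‖ := by
  have hN : (0 : ℝ) < N := by exact_mod_cast hv.pos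
  have ht' : (0 : ℝ) < t := by exact_mod_cast ht
  have h1 := hv.far t ht w hw hwv
  have h2 := norm_sub_le (x - w) (x - ratPoint v)
  rw [show x - w - (x - ratPoint v) = ratPoint v - w by abel] at h2
  have h3 : s + ψ t ≤ κ / (N * t) := by
    rw [le_div_iff₀ (by positivity)]; linarith
  linarith

/-- Points close to a balanced rational point, itself close to a badly approximable point, avoid
the rational points of smaller height. -/
lemma IsBalanced.le_norm_sub_of_near {n : ℕ} (hn : 1 ≤ n) {ψ : ℕ → ℝ} (hpos : ∀ s, 0 < ψ s)
    (hanti : Antitone ψ) {d κ : ℝ} (hd : 0 < d) (hd1 : d ≤ 1) (hκ : 0 < κ) (hκ1 : κ ≤ 1)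
    {v : Fin n → ℚ} {N : ℕ} (hv : IsBalanced d κ v N) {x y : Fin n → ℝ}
    (hy : ‖y - ratPoint v‖ < 1 / (commonDen v * N))
    (hx : ‖x - ratPoint v‖ ≤ ψ (commonDen v)) {t : ℕ} (ht : 0 < t) (htv : t ≤ commonDen v)
    (hψ : (t : ℝ) ^ (n + 1) * ψ t ^ n ≤ (κ * d / 8) ^ n * (d / 4))
    {w : Fin n → ℝ} (hw : w ∈ fracPoints n t) (hwv : w ≠ ratPoint v)
    (hyw : d ^ n ≤ (t : ℝ) ^ (n + 1) * ‖y - w‖ ^ n) : ψ t ≤ ‖x - w‖ := by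
  have hN : (0 : ℝ) < N := by exact_mod_cast hv.pos
  have ht' : (0 : ℝ) < t := by exact_mod_cast ht
  have hn0 : n ≠ 0 := by omega
  set q := commonDen v with hq
  have htq : (t : ℝ) ≤ q := by exact_mod_cast htv
  have hq' : (0 : ℝ) < q := ht'.trans_le htq
  have hψt := hpos t
  have hqt : ψ q ≤ ψ t := hanti htv
  by_cases hc : d / 4 * q ≤ t
  · refine hv.le_norm_sub hx ht ?_ hw hwv
    have h1 : (N * t * (2 * ψ t)) ^ n ≤ κ ^ n := by
      have h2 : (d * N) ^ n * (d / 4) ≤ t := by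
        refine le_trans ?_ hc
        rw [mul_comm]
        gcongr
        exact hv.le_den
      have h3 : d ^ n * (d / 4) * (N * t * (2 * ψ t)) ^ n ≤ d ^ n * (d / 4) * κ ^ n := by
        calc d ^ n * (d / 4) * (N * t * (2 * ψ t)) ^ n
            = ((d * N) ^ n * (d / 4)) * (t ^ n * (2 ^ n * ψ t ^ n)) := by
              simp only [mul_pow]; ring
          _ ≤ t * (t ^ n * (2 ^ n * ψ t ^ n)) := by gcongr
          _ = 2 ^ n * (t ^ (n + 1) * ψ t ^ n) := by ring
          _ ≤ 2 ^ n * ((κ * d / 8) ^ n * (d / 4)) := by gcongr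
          _ = (κ * d / 4) ^ n * (d / 4) := by rw [← mul_assoc, ← mul_pow]; ring_nf
          _ ≤ (κ * d) ^ n * (d / 4) := by
              gcongr
              linarith [mul_pos hκ hd]
          _ = d ^ n * (d / 4) * κ ^ n := by rw [mul_pow]; ring
      exact le_of_mul_le_mul_left h3 (by positivity)
    have h2 := le_of_pow_le_pow_left₀ hn0 hκ.le h1
    refine le_trans ?_ h2
    gcongr
    linarith
  · push Not at hc
    by_contra! hlt
    have h1 : ‖y - w‖ ≤ 2 * ψ t + 1 / (q * N) := by
      have h2 := norm_sub_le (y - ratPoint v) (x - ratPoint v)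
      have h3 := norm_add_le (y - x) (x - w)
      rw [sub_sub_sub_cancel_right] at h2
      rw [sub_add_sub_cancel] at h3
      linarith
    rcases le_total (2 * ψ t) (1 / (q * N)) with h | h
    · have h2 : (t : ℝ) ^ (n + 1) * ‖y - w‖ ^ n ≤ (d / 2) ^ n * (d / 4) := by
        calc (t : ℝ) ^ (n + 1) * ‖y - w‖ ^ n
            ≤ (d / 4 * q) ^ (n + 1) * (2 * (1 / (q * N))) ^ n := by
              gcongr
              linarith
          _ = (d / 2) ^ n * (d / 4) * (q / (N : ℝ) ^ n) := by
              rw [show (d / 4 * q) ^ (n + 1) * (2 * (1 / (q * N))) ^ n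
                = (d / 4 * q * (2 * (1 / (q * N)))) ^ n * (d / 4 * q) by rw [mul_pow _ (2 * _)]; ring,
                show d / 4 * q * (2 * (1 / (q * N))) = d / 2 / N by field_simp; ring, div_pow]
              ring
          _ ≤ (d / 2) ^ n * (d / 4) * 1 := by
              gcongr
              rw [div_le_one (by positivity)]
              exact hv.den_le
          _ = _ := mul_one _
      have h3 : (d / 2) ^ n * (d / 4) < d ^ n * 1 :=
        mul_lt_mul' (by gcongr; linarith) (by linarith) (by positivity) (by positivity)
      linarith
    · have h2 : (t : ℝ) ^ (n + 1) * ‖y - w‖ ^ n ≤ (κ * d / 2) ^ n * (d / 4) := by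
        calc (t : ℝ) ^ (n + 1) * ‖y - w‖ ^ n
            ≤ (t : ℝ) ^ (n + 1) * (4 * ψ t) ^ n := by
              gcongr
              linarith
          _ = 4 ^ n * ((t : ℝ) ^ (n + 1) * ψ t ^ n) := by rw [mul_pow]; ring
          _ ≤ 4 ^ n * ((κ * d / 8) ^ n * (d / 4)) := by gcongr
          _ = _ := by rw [← mul_assoc, ← mul_pow]; ring_nf
      have h3 : (κ * d / 2) ^ n * (d / 4) < d ^ n * 1 :=
        mul_lt_mul' (by gcongr; nlinarith) (by linarith) (by positivity) (by positivity)
      linarith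

lemma one_le_pow_mul_pow_of_lt {n : ℕ} (hn : 1 ≤ n) {d κ ε s t N q : ℝ} (hd : 0 < d) (hκ : 0 < κ)
    (hε : 0 < ε) (hs : 0 < s) (hN : 0 < N) (hq : (d * N) ^ n ≤ q) (ht : κ ≤ 2 * (N * t * s))
    (hqs : q ^ (n + 1) * s ^ n ≤ ((κ / 2) ^ (n + 1) * (ε / 8) ^ n * d ^ (n + 1)) ^ n) :
    1 ≤ t ^ (n + 1) * (ε * s / 8) ^ n := by
  have h1 : (N ^ (n + 1) * s * d ^ (n + 1)) ^ n
      ≤ ((κ / 2) ^ (n + 1) * (ε / 8) ^ n * d ^ (n + 1)) ^ n := by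
    refine le_trans ?_ hqs
    calc (N ^ (n + 1) * s * d ^ (n + 1)) ^ n = ((d * N) ^ n) ^ (n + 1) * s ^ n := by
          simp only [mul_pow, ← pow_mul]; ring_nf
      _ ≤ q ^ (n + 1) * s ^ n := by gcongr
  have h2 := le_of_pow_le_pow_left₀ (by omega) (by positivity) h1
  have h3 : N ^ (n + 1) * s ≤ (κ / 2) ^ (n + 1) * (ε / 8) ^ n :=
    le_of_mul_le_mul_right h2 (by positivity)
  have h4 : N ^ (n + 1) * s * 1 ≤ N ^ (n + 1) * s * (t ^ (n + 1) * (ε * s / 8) ^ n) := by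
    calc N ^ (n + 1) * s * 1 ≤ (κ / 2) ^ (n + 1) * (ε / 8) ^ n := by rw [mul_one]; exact h3
      _ ≤ (N * t * s) ^ (n + 1) * (ε / 8) ^ n := by gcongr; linarith
      _ = N ^ (n + 1) * s * (t ^ (n + 1) * (ε * s / 8) ^ n) := by
          rw [show ε * s / 8 = s * (ε / 8) by ring]
          simp only [mul_pow, pow_succ]; ring
  exact le_of_mul_le_mul_left h4 (by positivity)

/-- The inductive step: from a balanced rational point to the next one. -/
lemma IsBalanced.exists_next {n : ℕ} (hn : 1 ≤ n) {ψ : ℕ → ℝ} (hpos : ∀ s, 0 < ψ s)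
    (hanti : Antitone ψ) (hlim : Tendsto (fun s : ℕ => (s : ℝ) ^ (n + 1) * ψ s ^ n) atTop (nhds 0))
    {d κ : ℝ} (hd : 0 < d) (hd1 : d ≤ 1) (hκ : 0 < κ) (hκ1 : κ ≤ 1)
    (hex : ∀ (a : Fin n → ℝ) (ρ : ℝ), 0 < ρ →
      ∃ y ∈ Metric.closedBall a ρ, (∀ t : ℕ, 0 < t → ∀ w ∈ fracPoints n t,
        d * ρ ≤ ‖y - w‖ ∨ d ^ n ≤ (t : ℝ) ^ (n + 1) * ‖y - w‖ ^ n) ∧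
        ∀ L : ℕ, ∃ (v : Fin n → ℚ) (N : ℕ), IsBalanced d κ v N ∧ L ≤ commonDen v ∧
          ‖y - ratPoint v‖ < 1 / (commonDen v * N))
    {ε : ℝ} (hε : 0 < ε) (hε1 : ε < 1) :
    ∃ K : ℕ, ∀ (v : Fin n → ℚ) (N : ℕ), IsBalanced d κ v N → K ≤ commonDen v →
      ∀ (z : Fin n → ℝ) (L : ℕ), ∃ (v' : Fin n → ℚ) (N' : ℕ), IsBalanced d κ v' N' ∧
        L ≤ commonDen v' ∧ ∀ x ∈ Metric.closedBall (ratPoint v') (ψ (commonDen v')),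
          x ≠ z ∧ (1 - ε) * ψ (commonDen v) ≤ ‖x - ratPoint v‖ ∧
          ‖x - ratPoint v‖ < ψ (commonDen v) ∧
          ∀ w : Fin n → ℚ, commonDen v ≤ commonDen w → commonDen w ≤ commonDen v' →
            w ≠ v → w ≠ v' → ψ (commonDen w) ≤ ‖x - ratPoint w‖ := by
  have hev1 := hlim.eventually (ge_mem_nhds
    (by positivity : 0 < ((κ / 2) ^ (n + 1) * (ε / 8) ^ n * d ^ (n + 1)) ^ n))
  have hev2 := hlim.eventually (ge_mem_nhds (by positivity : 0 < (κ * d / 8) ^ n * (d / 4)))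
  obtain ⟨K, hK⟩ := eventually_atTop.mp (hev1.and hev2)
  refine ⟨K, fun v N hv hKv z L => ?_⟩
  set q := commonDen v with hq
  have hs := hpos q
  obtain ⟨a, ha⟩ := exists_closedBall_in_shell hn (ratPoint v) z hs hε hε1
  have hρ : 0 < ε * ψ q / 8 := by positivity
  obtain ⟨y, hya, hy, hL⟩ := hex a (ε * ψ q / 8) hρ
  obtain ⟨L', hL'⟩ : ∃ L' : ℕ, ∀ s ≥ L', 0 < s → ψ s + 1 / s ≤ ε * ψ q / 8 := by
    have hev3 := hlim.eventually (ge_mem_nhds one_pos)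
    have hev4 := (tendsto_one_div_atTop_nhds_zero_nat (𝕜 := ℝ)).eventually
      (ge_mem_nhds (by positivity : 0 < ε * ψ q / 8 / 2))
    obtain ⟨L', hL'⟩ := eventually_atTop.mp (hev3.and hev4)
    refine ⟨L', fun s hsL hs0 => ?_⟩
    obtain ⟨h1, h2⟩ := hL' s hsL
    have hs1 : (1 : ℝ) ≤ s := by exact_mod_cast hs0
    have h3 : ψ s ≤ 1 / s := by
      rw [le_div_iff₀ (by linarith)]
      have h4 : (ψ s * s) ^ n ≤ 1 ^ n := by
        rw [one_pow, mul_pow, mul_comm]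
        refine le_trans ?_ h1
        have := (hpos s).le
        gcongr
        omega
      exact le_of_pow_le_pow_left₀ (by omega) zero_le_one h4
    linarith
  obtain ⟨v', N', hv', hLv', hyv'⟩ := hL (max L L')
  refine ⟨v', N', hv', (le_max_left _ _).trans hLv', fun x hx => ?_⟩
  set q' := commonDen v' with hq'
  rw [Metric.mem_closedBall, dist_eq_norm] at hx
  have hq'pos : 0 < q' := commonDen_pos v'
  have hq'R : (0 : ℝ) < q' := by exact_mod_cast hq'pos
  have hN'1 : (1 : ℝ) ≤ N' := by exact_mod_cast hv'.pos
  have hxa : x ∈ Metric.closedBall a (ε * ψ q / 4) := by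
    rw [Metric.mem_closedBall, dist_eq_norm] at hya ⊢
    have h1 := norm_sub_le (x - ratPoint v') (y - ratPoint v')
    have h2 := norm_add_le (x - y) (y - a)
    rw [sub_sub_sub_cancel_right] at h1
    rw [sub_add_sub_cancel] at h2
    have h3 : 1 / ((q' : ℝ) * N') ≤ 1 / q' := by
      gcongr
      exact le_mul_of_one_le_right hq'R.le hN'1
    have h4 := hL' q' ((le_max_right _ _).trans hLv') hq'pos
    linarith
  obtain ⟨hxz, hxv, hxv'⟩ := ha x hxa
  refine ⟨hxz, hxv, hxv', fun w hqw hwq' hwv hwv' => ?_⟩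
  set t := commonDen w with ht
  have htpos : 0 < t := commonDen_pos w
  have htR : (0 : ℝ) < t := by exact_mod_cast htpos
  have hNR : (0 : ℝ) < N := by exact_mod_cast hv.pos
  have hwt := ratPoint_mem_fracPoints w
  by_cases hc : 2 * (N * t * ψ q) ≤ κ
  · refine hv.le_norm_sub hxv'.le htpos ?_ hwt (ratPoint_injective.ne hwv)
    have h1 : N * t * ψ t ≤ N * t * ψ q := by
      gcongr
      exact hanti hqw
    rw [mul_add]; linarith
  · refine hv'.le_norm_sub_of_near hn hpos hanti hd hd1 hκ hκ1 hyv' hx htpos hwq'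
      (hK t (hKv.trans hqw)).2 hwt (ratPoint_injective.ne hwv') ?_
    rcases hy t htpos _ hwt with h | h
    · have h1 := one_le_pow_mul_pow_of_lt hn hd hκ hε hs hNR hv.le_den (le_of_not_ge hc)
        (hK q hKv).1
      calc d ^ n ≤ d ^ n * ((t : ℝ) ^ (n + 1) * (ε * ψ q / 8) ^ n) :=
            le_mul_of_one_le_right (by positivity) h1
        _ = (t : ℝ) ^ (n + 1) * (d * (ε * ψ q / 8)) ^ n := by rw [mul_pow d]; ring
        _ ≤ (t : ℝ) ^ (n + 1) * ‖y - ratPoint w‖ ^ n := by gcongr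
    · exact h

lemma finite_ratPoint_near {n : ℕ} (x : Fin n → ℝ) (R : ℝ) (L : ℕ) :
    {v : Fin n → ℚ | commonDen v ≤ L ∧ ‖x - ratPoint v‖ ≤ R}.Finite := by
  obtain ⟨B, hB⟩ := exists_nat_gt (‖x‖ + R)
  have hfin : ((fun p : ℤ × ℕ => (p.1 : ℚ) / p.2) ''
      (Set.Icc (-(B * L : ℤ)) (B * L) ×ˢ Set.Iic L)).Finite :=
    ((Set.finite_Icc _ _).prod (Set.finite_Iic _)).image _
  refine (Set.Finite.pi' fun _ : Fin n => hfin).subset ?_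
  rintro v ⟨hvL, hvR⟩ i
  have hden : (v i).den ≤ L :=
    (Nat.le_of_dvd (commonDen_pos v) (Finset.dvd_lcm (Finset.mem_univ i))).trans hvL
  refine ⟨((v i).num, (v i).den), ⟨?_, hden⟩, Rat.num_div_den (v i)⟩
  have h1 : |(v i : ℝ)| ≤ B := by
    have h2 := norm_le_pi_norm (ratPoint v) i
    have h3 := norm_sub_le x (x - ratPoint v)
    rw [sub_sub_cancel] at h3
    rw [Real.norm_eq_abs] at h2
    exact h2.trans (by linarith)
  have h2 : |((v i).num : ℝ)| ≤ B * L := by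
    have h3 : ((v i).num : ℝ) = (v i : ℝ) * (v i).den := by
      exact_mod_cast (Rat.mul_den_eq_num (v i)).symm
    rw [h3, abs_mul, Nat.abs_cast]
    gcongr
  rw [Set.mem_Icc, ← abs_le]
  exact_mod_cast h2

/-- No sequence exhausts the exactly `ψ`-approximable points. -/
lemma exists_mem_Eapprox_forall_ne {n : ℕ} (hn : 1 ≤ n) {ψ : ℕ → ℝ} (hpos : ∀ s, 0 < ψ s)
    (hanti : Antitone ψ) (hlim : Tendsto (fun s : ℕ => (s : ℝ) ^ (n + 1) * ψ s ^ n) atTop (nhds 0))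
    (z : ℕ → Fin n → ℝ) : ∃ x ∈ Eapprox n ψ, ∀ k, x ≠ z k := by
  obtain ⟨d, κ, hd, hd1, hκ, hκ1, hex⟩ := exists_badly_approximable_balanced hn
  let ε : ℕ → ℝ := fun k => 1 / ((k : ℝ) + 2)
  have hε : ∀ k, 0 < ε k := fun k => by positivity
  have hε1 : ∀ k, ε k < 1 := fun k => by
    simp only [ε]
    rw [div_lt_one (by positivity)]
    linarith [(Nat.cast_nonneg k : (0 : ℝ) ≤ k)]
  have hstep := fun k =>
    IsBalanced.exists_next hn hpos hanti hlim hd hd1 hκ hκ1 hex (hε k) (hε1 k)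
  choose K hK using hstep
  let State : ℕ → Type := fun k =>
    {p : (Fin n → ℚ) × ℕ // IsBalanced d κ p.1 p.2 ∧ K k ≤ commonDen p.1}
  have hnext : ∀ k (p : State k), ∃ p' : State (k + 1), commonDen p.1.1 < commonDen p'.1.1 ∧
      ∀ x ∈ Metric.closedBall (ratPoint p'.1.1) (ψ (commonDen p'.1.1)),
        x ≠ z k ∧ (1 - ε k) * ψ (commonDen p.1.1) ≤ ‖x - ratPoint p.1.1‖ ∧
          ‖x - ratPoint p.1.1‖ < ψ (commonDen p.1.1) ∧
          ∀ w : Fin n → ℚ, commonDen p.1.1 ≤ commonDen w → commonDen w ≤ commonDen p'.1.1 →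
            w ≠ p.1.1 → w ≠ p'.1.1 → ψ (commonDen w) ≤ ‖x - ratPoint w‖ := by
    rintro k ⟨⟨v, N⟩, hv, hKv⟩
    obtain ⟨v', N', hv', hL, h⟩ := hK k v N hv hKv (z k) (max (commonDen v + 1) (K (k + 1)))
    exact ⟨⟨(v', N'), hv', (le_max_right _ _).trans hL⟩,
      Nat.lt_of_succ_le ((le_max_left _ _).trans hL), h⟩
  choose f hf1 hf2 using hnext
  obtain ⟨p₀⟩ : Nonempty (State 0) := by
    obtain ⟨y, -, -, h⟩ := hex 0 1 one_pos
    obtain ⟨v, N, hv, hKv, -⟩ := h (K 0)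
    exact ⟨⟨(v, N), hv, hKv⟩⟩
  let S : ∀ k, State k := fun k => Nat.rec p₀ (fun k p => f k p) k
  let V : ℕ → Fin n → ℚ := fun k => (S k).1.1
  have hmono : StrictMono fun k => commonDen (V k) := strictMono_nat_of_lt_succ fun k => hf1 k (S k)
  have hV := fun k => hf2 k (S k)
  obtain ⟨x, hx⟩ := IsCompact.nonempty_iInter_of_sequence_nonempty_isCompact_isClosed
    (fun k => Metric.closedBall (ratPoint (V k)) (ψ (commonDen (V k))))
    (fun k x hx => by
      rw [Metric.mem_closedBall, dist_eq_norm]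
      exact (hV k x hx).2.2.1.le)
    (fun k => ⟨_, Metric.mem_closedBall_self (hpos _).le⟩)
    (isCompact_closedBall _ _) (fun k => Metric.isClosed_closedBall)
  rw [Set.mem_iInter] at hx
  have hxV := fun k => hV k x (hx (k + 1))
  have hother : ∀ w : Fin n → ℚ, commonDen (V 0) ≤ commonDen w → (∀ k, w ≠ V k) →
      ψ (commonDen w) ≤ ‖x - ratPoint w‖ := by
    intro w hw hwV
    have hex' : ∃ k, commonDen w < commonDen (V k) :=
      ⟨commonDen w + 1, (Nat.lt_succ_self _).trans_le (hmono.le_apply)⟩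
    rcases hk : Nat.find hex' with _ | k
    · have := Nat.find_spec hex'
      rw [hk] at this
      omega
    · have h1 := Nat.find_spec hex'
      rw [hk] at h1
      have h2 := Nat.find_min hex' (by omega : k < Nat.find hex')
      exact (hxV k).2.2.2 w (not_lt.mp h2) h1.le (hwV k) (hwV (k + 1))
  refine ⟨x, ⟨?_, ?_⟩, fun k => (hxV k).1⟩
  · exact Set.infinite_of_injective_forall_mem (f := V)
      (fun k l hkl => hmono.injective (congrArg commonDen hkl)) fun k => (hxV k).2.2.1
  · simp only [Set.mem_iUnion, not_exists]
    rintro c ⟨hc0, hc1⟩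
    rw [Wapprox, Set.mem_ofPred_eq, Set.not_infinite]
    obtain ⟨m, hm⟩ := exists_nat_gt (1 / (1 - c))
    refine ((finite_ratPoint_near x (ψ 0) (commonDen (V 0))).union
      ((Set.finite_Iio m).image V)).subset fun w hw => ?_
    have hw' : ‖x - ratPoint w‖ < c * ψ (commonDen w) := hw
    have hψw := hpos (commonDen w)
    have hlt : ‖x - ratPoint w‖ < ψ (commonDen w) := by nlinarith
    by_cases hwV : ∃ k, w = V k
    · obtain ⟨k, rfl⟩ := hwV
      refine Or.inr ⟨k, ?_, rfl⟩
      rw [Set.mem_Iio]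
      by_contra! hmk
      have h1 : ε k ≤ 1 - c := by
        have hmk' : (m : ℝ) ≤ k := by exact_mod_cast hmk
        rw [div_lt_iff₀ (by linarith)] at hm
        simp only [ε]
        rw [div_le_iff₀ (by positivity)]
        nlinarith
      have h2 : (1 - ε k) * ψ (commonDen (V k)) ≤ ‖x - ratPoint (V k)‖ := (hxV k).2.1
      nlinarith
    · push Not at hwV
      refine Or.inl ⟨?_, hlt.le.trans (hanti (Nat.zero_le _))⟩
      by_contra! h
      exact absurd (hother w h.le hwV) (not_le.mpr hlt)

/-- Existence of exactly `ψ`-approximable vectors: if `ψ` is non-increasing and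
`s^{(n+1)/n} ψ(s) → 0`, then `E(ψ)` is non-empty, and in fact uncountable. -/
theorem exact_approx_nonempty (n : ℕ) (hn : 1 ≤ n) (ψ : ℕ → ℝ)
    (hpos : ∀ s, 0 < ψ s) (hanti : Antitone ψ)
    (hsmall : Tendsto (fun s : ℕ => (s : ℝ) ^ (((n : ℝ) + 1) / n) * ψ s) atTop (nhds 0)) :
    (Eapprox n ψ).Nonempty ∧ ¬ (Eapprox n ψ).Countable := by
  have hlim : Tendsto (fun s : ℕ => (s : ℝ) ^ (n + 1) * ψ s ^ n) atTop (nhds 0) := by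
    have h := hsmall.pow n
    rw [zero_pow (by omega)] at h
    refine h.congr fun s => ?_
    have hn' : (n : ℝ) ≠ 0 := by positivity
    rw [mul_pow, ← Real.rpow_natCast, ← Real.rpow_mul (Nat.cast_nonneg s),
      div_mul_cancel₀ _ hn', ← Real.rpow_natCast (s : ℝ) (n + 1)]
    push_cast
    rfl
  have key := exists_mem_Eapprox_forall_ne hn hpos hanti hlim
  have hne : (Eapprox n ψ).Nonempty := (key fun _ => 0).imp fun x hx => hx.1
  refine ⟨hne, fun hcount => ?_⟩
  obtain ⟨z, hz⟩ := hcount.exists_eq_range hne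
  obtain ⟨x, hx, hxz⟩ := key z
  rw [hz] at hx
  obtain ⟨k, hk⟩ := hx
  exact hxz k hk.symm
end

section
/- Let n ≥ 1 and ψ: ℕ → ℝ⁺ non-increasing with ψ(s) = o(s^{−(n+1)/n}). Then dim_H E(ψ) = dim_H W(ψ); in particular if λ_ψ = liminf (−log ψ(s))/(log s) is finite, dim_H E(ψ) = (n+1)/λ_ψ. -/
open Real Filter MeasureTheory

/-- The height of a rational point: the least common denominator of its coordinates. -/
def ratHeight {n : ℕ} (v : Fin n → ℚ) : ℕ := Finset.univ.lcm fun i => (v i).den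

lemma ratHeight_pos {n : ℕ} (v : Fin n → ℚ) : 0 < ratHeight v := by
  refine Nat.pos_of_ne_zero fun h => ?_
  obtain ⟨i, -, hi⟩ := Finset.lcm_eq_zero_iff.1 h
  exact (v i).den_nz hi

lemma exists_int_eq_ratHeight_mul {n : ℕ} (v : Fin n → ℚ) :
    ∃ p : Fin n → ℤ, ∀ i, (p i : ℝ) = ratHeight v * ratPoint v i := by
  have h : ∀ i, ∃ p : ℤ, (p : ℝ) = ratHeight v * ratPoint v i := fun i => by
    obtain ⟨k, hk⟩ : (v i).den ∣ ratHeight v :=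
      Finset.dvd_lcm (f := fun i => (v i).den) (Finset.mem_univ i)
    refine ⟨k * (v i).num, ?_⟩
    have h1 : ((v i).den : ℝ) * (v i : ℝ) = (v i).num := by
      exact_mod_cast Rat.den_mul_eq_num (v i)
    rw [hk]
    simp only [ratPoint]
    push_cast
    rw [← h1]; ring
  choose p hp using h
  exact ⟨p, hp⟩

lemma ratHeight_le_of_int {n : ℕ} (v : Fin n → ℚ) {q : ℕ} (hq : 0 < q) (p : Fin n → ℤ)
    (h : ∀ i, v i = p i / q) : ratHeight v ≤ q := by
  refine Nat.le_of_dvd hq (Finset.lcm_dvd fun i _ => ?_)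
  rw [h i]
  have := Rat.den_dvd (p i) q
  rw [Rat.divInt_eq_div] at this
  exact_mod_cast this

/-- There are finitely many rational points of bounded height in a bounded region. -/
lemma finite_ratPoint_of_height_le {n : ℕ} (c : Fin n → ℝ) (r : ℝ) (Q : ℕ) :
    {v : Fin n → ℚ | ‖ratPoint v - c‖ ≤ r ∧ ratHeight v ≤ Q}.Finite := by
  have key : Set.Finite (Set.image2 (fun (q : ℕ) (p : Fin n → ℤ) => fun i => (p i : ℚ) / q)
      (Set.Iic Q) (Set.pi Set.univ fun i =>
        Set.Icc (⌊-(Q * (r + |c i|))⌋) ⌈Q * (r + |c i|)⌉)) :=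
    (Set.finite_Iic Q).image2 _ (Set.Finite.pi fun i => Set.finite_Icc _ _)
  refine key.subset ?_
  rintro v ⟨hv, hQ⟩
  obtain ⟨p, hp⟩ := exists_int_eq_ratHeight_mul v
  have h0 := ratHeight_pos v
  refine ⟨ratHeight v, hQ, p, fun i _ => ?_, ?_⟩
  · have h1 : |ratPoint v i - c i| ≤ r := (norm_le_pi_norm (ratPoint v - c) i).trans hv
    have h2 : |ratPoint v i| ≤ r + |c i| := by
      have := abs_sub_abs_le_abs_sub (ratPoint v i) (c i); linarith
    have h3 : |(p i : ℝ)| ≤ Q * (r + |c i|) := by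
      rw [hp, abs_mul, Nat.abs_cast]
      gcongr
    rw [abs_le] at h3
    exact ⟨by exact_mod_cast (Int.floor_le _).trans h3.1,
      by exact_mod_cast h3.2.trans (Int.le_ceil _)⟩
  · funext i
    have : (p i : ℚ) = ratHeight v * v i := by
      have := hp i
      simp only [ratPoint] at this
      exact_mod_cast this
    simp only [this]
    field_simp

lemma abs_det_le_of_first_col {n : ℕ} {t : ℝ} (ht : 0 < t) (w : Unit ⊕ Fin n → Fin n → ℝ)
    (c : Fin n → ℝ) (hw : ∀ k, ‖w k - c‖ ≤ t) :
    |(Matrix.of fun k => Sum.elim (fun _ : Unit => (1 : ℝ)) (w k)).det| ≤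
      (n + 1).factorial * t ^ n := by
  set W : Matrix (Unit ⊕ Fin n) (Unit ⊕ Fin n) ℝ :=
    Matrix.of fun k => Sum.elim (fun _ : Unit => (1 : ℝ)) (w k) with hW
  set U : Matrix (Unit ⊕ Fin n) (Unit ⊕ Fin n) ℝ :=
    Matrix.fromBlocks (Matrix.of fun _ _ => t) (Matrix.of fun _ i => - c i) 0 1 with hU
  have hdet : (W * U).det = W.det * t := by
    rw [Matrix.det_mul, hU, Matrix.det_fromBlocks_zero₂₁]
    simp
  have hle : ∀ i j, |(W * U) i j| ≤ t := by
    rintro k (j | j)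
    · simp [Matrix.mul_apply, hW, hU, abs_of_pos ht]
    · have : (W * U) k (Sum.inr j) = w k j - c j := by
        simp [Matrix.mul_apply, hW, hU, Matrix.one_apply]
        ring
      rw [this]
      exact (norm_le_pi_norm (w k - c) j).trans (hw k)
  have h := Matrix.det_le (abv := AbsoluteValue.abs) hle
  simp only [AbsoluteValue.abs_apply, hdet, Fintype.card_sum, Fintype.card_unit, Fintype.card_fin,
    nsmul_eq_mul, abs_mul, abs_of_pos ht, add_comm 1 n] at h
  rw [pow_succ, ← mul_assoc] at h
  exact le_of_mul_le_mul_right h ht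

/-- The simplex lemma: rational points of small height in a small ball lie on a hyperplane. -/
lemma exists_hyperplane_of_small_height {n : ℕ} (hn : 1 ≤ n) (c : Fin n → ℝ) {t : ℝ} (ht : 0 < t)
    (S : Set (Fin n → ℚ)) (hS : ∀ w ∈ S, ‖ratPoint w - c‖ ≤ t)
    (hH : ∀ w ∈ S, (n + 1).factorial * t ^ n * (ratHeight w : ℝ) ^ (n + 1) < 1) :
    ∃ (a : Fin n → ℝ) (b : ℝ), a ≠ 0 ∧ ∀ w ∈ S, ∑ i, a i * ratPoint w i = b := by
  classical
  set vec : (Fin n → ℚ) → (Unit ⊕ Fin n → ℝ) :=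
    fun w => Sum.elim (fun _ => 1) (ratPoint w) with hvec
  rcases S.eq_empty_or_nonempty with rfl | ⟨w₀, hw₀⟩
  · exact ⟨fun _ => 1, 0, fun h => by simpa using congrFun h ⟨0, hn⟩, by simp⟩
  by_cases hspan : Submodule.span ℝ (vec '' S) = ⊤
  · exfalso
    set B := Module.Basis.ofSpan hspan.ge
    have hBS := Module.Basis.ofSpan_subset hspan.ge
    let e := Module.Basis.indexEquiv B (Pi.basisFun ℝ (Unit ⊕ Fin n))
    set B' := B.reindex e
    have hmem : ∀ k, ∃ w ∈ S, vec w = B' k := fun k => by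
      have : B' k ∈ Set.range B := by simp [B']
      exact hBS this
    choose w hwS hw using hmem
    choose p hp using fun k => exists_int_eq_ratHeight_mul (w k)
    set W : Matrix (Unit ⊕ Fin n) (Unit ⊕ Fin n) ℝ := Matrix.of fun k => vec (w k) with hW
    have hW0 : W.det ≠ 0 := by
      have : LinearIndependent ℝ W.row := by
        have h : W.row = B' := funext hw
        rw [h]; exact B'.linearIndependent
      exact ((Matrix.isUnit_iff_isUnit_det _).1
        (Matrix.linearIndependent_rows_iff_isUnit.1 this)).ne_zero
    have hle := abs_det_le_of_first_col ht (fun k => ratPoint (w k)) c fun k => hS _ (hwS k)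
    set P : Matrix (Unit ⊕ Fin n) (Unit ⊕ Fin n) ℤ :=
      Matrix.of fun k => Sum.elim (fun _ => (ratHeight (w k) : ℤ)) (p k)
    have hP : P.map (Int.castRingHom ℝ) =
        Matrix.diagonal (fun k => (ratHeight (w k) : ℝ)) * W := by
      ext k (j | j)
      · simp [P, W, hvec]
      · simp [P, W, hvec, hp]
    have hPdet : ((P.det : ℤ) : ℝ) = (∏ k, (ratHeight (w k) : ℝ)) * W.det := by
      have := congrArg Matrix.det hP
      rw [Matrix.det_mul, Matrix.det_diagonal] at this
      rw [← this]
      exact RingHom.map_det (Int.castRingHom ℝ) P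
    have hprod : (0 : ℝ) < ∏ k, (ratHeight (w k) : ℝ) :=
      Finset.prod_pos fun k _ => by exact_mod_cast ratHeight_pos (w k)
    have hP0 : P.det ≠ 0 := fun h => by
      rw [h, Int.cast_zero] at hPdet
      exact mul_ne_zero hprod.ne' hW0 hPdet.symm
    have h1 : (1 : ℝ) ≤ (∏ k, (ratHeight (w k) : ℝ)) * ((n + 1).factorial * t ^ n) := by
      calc (1 : ℝ) ≤ |((P.det : ℤ) : ℝ)| := by exact_mod_cast Int.one_le_abs hP0
        _ = (∏ k, (ratHeight (w k) : ℝ)) * |W.det| := by rw [hPdet, abs_mul, abs_of_pos hprod]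
        _ ≤ _ := by gcongr
    obtain ⟨k₀, -, hk₀⟩ := Finset.exists_max_image Finset.univ (fun k => ratHeight (w k))
      ⟨Sum.inl (), Finset.mem_univ _⟩
    have h2 : ∏ k, (ratHeight (w k) : ℝ) ≤ (ratHeight (w k₀) : ℝ) ^ (n + 1) := by
      refine (Finset.prod_le_prod (fun k _ => Nat.cast_nonneg _)
        fun k hk => Nat.cast_le.2 (hk₀ k hk)).trans_eq ?_
      simp [add_comm]
    have h3 := hH _ (hwS k₀)
    have h4 : (0 : ℝ) ≤ (n + 1).factorial * t ^ n := by positivity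
    nlinarith [mul_le_mul_of_nonneg_right h2 h4]
  · obtain ⟨f, hf0, hf⟩ := Submodule.exists_le_ker_of_lt_top _ (lt_top_iff_ne_top.2 hspan)
    have hfv : ∀ w ∈ S, f (Pi.single (Sum.inl ()) 1) +
        ∑ i, f (Pi.single (Sum.inr i) 1) * ratPoint w i = 0 := fun w hw => by
      have h0 : f (vec w) = 0 := hf (Submodule.subset_span ⟨w, hw, rfl⟩)
      rw [pi_eq_sum_univ' (vec w), map_sum, Fintype.sum_sum_type] at h0
      simpa [hvec, mul_comm] using h0
    refine ⟨fun i => f (Pi.single (Sum.inr i) 1), - f (Pi.single (Sum.inl ()) 1), fun h0 => hf0 ?_,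
      fun w hw => by linarith [hfv w hw]⟩
    have h1 : ∀ i, f (Pi.single (Sum.inr i) 1) = 0 := fun i => congrFun h0 i
    have h2 : f (Pi.single (Sum.inl ()) 1) = 0 := by simpa [h1] using hfv w₀ hw₀
    refine LinearMap.pi_ext' fun j => LinearMap.ext_ring ?_
    rcases j with j | j
    · simpa using h2
    · simpa using h1 j

lemma abs_sum_sub_le_of_mem_hyperplane {n : ℕ} {a w : Fin n → ℝ} {b : ℝ} (hw : ∑ i, a i * w i = b)
    (x : Fin n → ℝ) : |∑ i, a i * x i - b| ≤ (∑ i, |a i|) * ‖x - w‖ := by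
  rw [← hw, ← Finset.sum_sub_distrib, Finset.sum_mul]
  refine (Finset.abs_sum_le_sum_abs _ _).trans (Finset.sum_le_sum fun i _ => ?_)
  rw [← mul_sub, abs_mul]
  gcongr
  exact norm_le_pi_norm (x - w) i

lemma exists_signs {n : ℕ} (a : Fin n → ℝ) :
    ∃ σ : Fin n → ℝ, (∀ i, a i * σ i = |a i|) ∧ ∀ i, |σ i| = 1 := by
  refine ⟨fun i => if 0 ≤ a i then 1 else -1, fun i => ?_, fun i => ?_⟩
  · dsimp only; split_ifs with h
    · rw [abs_of_nonneg h, mul_one]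
    · rw [abs_of_neg (not_le.1 h)]; ring
  · dsimp only; split_ifs <;> simp

lemma sum_abs_pos {n : ℕ} {a : Fin n → ℝ} (ha : a ≠ 0) : 0 < ∑ i, |a i| := by
  obtain ⟨i, hi⟩ := Function.ne_iff.1 ha
  exact Finset.sum_pos' (fun i _ => abs_nonneg _) ⟨i, Finset.mem_univ i, abs_pos.2 hi⟩

/-- A point whose sup-norm neighbourhood is far from a hyperplane is far from its points. -/
lemma le_norm_sub_of_hyperplane {n : ℕ} {a w x y : Fin n → ℝ} {b d e : ℝ} (ha : a ≠ 0)
    (hw : ∑ i, a i * w i = b) (hy : d * ∑ i, |a i| ≤ |∑ i, a i * y i - b|) (hxy : ‖x - y‖ ≤ e) :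
    d - e ≤ ‖x - w‖ := by
  have h1 := abs_sum_sub_le_of_mem_hyperplane hw y
  have h2 := sum_abs_pos ha
  have h3 : d ≤ ‖y - w‖ := by
    by_contra! h
    nlinarith
  have h4 : ‖y - w‖ ≤ ‖y - x‖ + ‖x - w‖ := norm_sub_le_norm_sub_add_norm_sub y x w
  rw [norm_sub_rev] at hxy
  linarith

/-- Subcubes of relative radius `1 / (4 * M)` that avoid all rational points of small height. -/
lemma exists_subcubes {n : ℕ} (hn : 1 ≤ n) {M : ℕ} (hM : 1 ≤ M) {R A : ℝ} (hR : R = 4 * M)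
    (hA : A = 1 / (2 * (n + 1).factorial * (2 * R) ^ n)) (c : Fin n → ℝ) {r : ℝ} (hr : 0 < r) :
    ∃ C : (Fin n → Fin M) → Fin n → ℝ,
      (∀ z, ‖C z - c‖ ≤ r - r / R) ∧ (∀ z z', z ≠ z' → 3 * (r / R) ≤ ‖C z - C z'‖) ∧
      ∀ z x w, ‖x - C z‖ ≤ r / R → (ratHeight w : ℝ) ^ (n + 1) * (r / R) ^ n ≤ A →
        r / R ≤ ‖x - ratPoint w‖ := by
  have hM' : (1 : ℝ) ≤ M := by exact_mod_cast hM
  have hR0 : 0 < R := by linarith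
  set u := r / R with hu
  have hu0 : 0 < u := by positivity
  have hur : u * (4 * M) = r := by rw [hu, ← hR]; field_simp
  obtain ⟨a, b, ha, hab⟩ := exists_hyperplane_of_small_height hn c (t := 2 * r) (by positivity)
    {w | ‖ratPoint w - c‖ ≤ 2 * r ∧ (ratHeight w : ℝ) ^ (n + 1) * u ^ n ≤ A}
    (fun w hw => hw.1) (fun w hw => by
      have h1 : (2 * r) ^ n = (2 * R) ^ n * u ^ n := by
        rw [← mul_pow, hu]; congr 1; field_simp
      have h2 : ((n + 1).factorial * (2 * R) ^ n : ℝ) * A = 1 / 2 := by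
        rw [hA]; field_simp
      have h3 : (0 : ℝ) < (n + 1).factorial * (2 * R) ^ n := by positivity
      rw [h1]
      nlinarith [mul_le_mul_of_nonneg_left hw.2 h3.le])
  obtain ⟨σ, hσa, hσ1⟩ := exists_signs a
  set g := ∑ i, a i * c i - b with hg
  set s : ℝ := if 0 ≤ g then 1 else -1 with hs
  have hs1 : |s| = 1 := by simp only [hs]; split_ifs <;> simp
  set C : (Fin n → Fin M) → Fin n → ℝ :=
    fun z i => c i + s * σ i * (3 * u * ((z i : ℕ) + 1)) with hC
  have hM1 : r - u = u * (4 * M - 1) := by rw [← hur]; ring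
  have hCc : ∀ z, ‖C z - c‖ ≤ r - u := fun z => by
    rw [pi_norm_le_iff_of_nonneg (by rw [hM1]; exact mul_nonneg hu0.le (by linarith))]
    intro i
    have h1 : ((z i : ℕ) : ℝ) + 1 ≤ M := by exact_mod_cast (z i).2
    simp only [Pi.sub_apply, hC, add_sub_cancel_left, Real.norm_eq_abs, abs_mul, hs1, hσ1, one_mul,
      abs_of_pos hu0, abs_of_pos (show (0 : ℝ) < (z i : ℕ) + 1 by positivity)]
    rw [hM1, abs_of_pos (by norm_num : (0 : ℝ) < 3)]
    nlinarith
  refine ⟨C, hCc, fun z z' hz => ?_, fun z x w hx hw => ?_⟩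
  · obtain ⟨i, hi⟩ := Function.ne_iff.1 hz
    refine le_trans ?_ (norm_le_pi_norm (C z - C z') i)
    have h1 : (C z - C z') i = s * σ i * (3 * u * (((z i : ℕ) : ℝ) - (z' i : ℕ))) := by
      simp only [Pi.sub_apply, hC]; ring
    have h2 : (1 : ℝ) ≤ |((z i : ℕ) : ℝ) - (z' i : ℕ)| := by
      have : ((z i : ℕ) : ℤ) - ((z' i : ℕ) : ℤ) ≠ 0 := fun h => hi (Fin.ext (by omega))
      exact_mod_cast Int.one_le_abs this
    rw [h1, Real.norm_eq_abs, abs_mul, abs_mul, hs1, hσ1, abs_mul, abs_of_pos (by positivity)]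
    nlinarith
  · by_cases hwc : ‖ratPoint w - c‖ ≤ 2 * r
    · have h1 : 3 * u * ∑ i, |a i| ≤ |∑ i, a i * C z i - b| := by
        have h2 : ∑ i, a i * C z i - b =
            g + s * ∑ i, |a i| * (3 * u * (((z i : ℕ) : ℝ) + 1)) := by
          simp only [hC, hg, mul_add (a _), Finset.sum_add_distrib, Finset.mul_sum]
          rw [add_sub_right_comm]
          congr 1
          refine Finset.sum_congr rfl fun i _ => ?_
          rw [← hσa]; ring
        have h3 : 3 * u * ∑ i, |a i| ≤ ∑ i, |a i| * (3 * u * (((z i : ℕ) : ℝ) + 1)) := by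
          rw [Finset.mul_sum]
          refine Finset.sum_le_sum fun i _ => ?_
          rw [mul_comm]
          refine mul_le_mul_of_nonneg_left ?_ (abs_nonneg _)
          have : (0 : ℝ) ≤ (z i : ℕ) := Nat.cast_nonneg _
          nlinarith
        rw [h2]
        refine h3.trans ?_
        simp only [hs]; split_ifs with h
        · exact le_trans (by linarith) (le_abs_self _)
        · exact le_trans (by linarith) (neg_le_abs _)
      have := le_norm_sub_of_hyperplane ha (hab w ⟨hwc, hw⟩) h1 hx
      linarith
    · have h1 := hCc z
      have h2 : ‖ratPoint w - c‖ ≤ ‖ratPoint w - x‖ + ‖x - c‖ :=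
        norm_sub_le_norm_sub_add_norm_sub _ _ _
      have h3 : ‖x - c‖ ≤ ‖x - C z‖ + ‖C z - c‖ := norm_sub_le_norm_sub_add_norm_sub _ _ _
      rw [norm_sub_rev x (ratPoint w)]
      nlinarith

/-- Inside a cube containing a rational point of controlled height, there is a smaller cube all of
whose points are approximated by a rational point `v` almost exactly to within `ψ (ratHeight v)`,
and not much better by any other rational point. -/
lemma exists_exact_cube {n : ℕ} (hn : 1 ≤ n) {ψ : ℕ → ℝ} (hpos : ∀ s, 0 < ψ s)
    (hanti : Antitone ψ) {R A ε r : ℝ} (hR : 4 ≤ R)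
    (hA : A = 1 / (2 * (n + 1).factorial * (2 * R) ^ n)) (hε : 0 < ε) (hε8 : ε ≤ 1 / 8)
    (hr : 0 < r) (c : Fin n → ℝ) (Q : ℕ) (v₀ : Fin n → ℚ) (hv₀ : ‖ratPoint v₀ - c‖ ≤ r / 2)
    (hv₀Q : ratHeight v₀ ≤ Q)
    (hc : ∀ w, ‖ratPoint w - c‖ ≤ r → A < (ratHeight w : ℝ) ^ (n + 1) * r ^ n)
    (hsm : ∀ t, 0 < t → t ≤ r → ∀ H : ℕ, A ≤ (H : ℝ) ^ (n + 1) * t ^ n → ψ H ≤ ε / (8 * R) * t) :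
    ∃ (v : Fin n → ℚ) (c' : Fin n → ℝ), ratHeight v ≤ Q ∧
      A < (ratHeight v : ℝ) ^ (n + 1) * r ^ n ∧ ψ (ratHeight v) ≤ r / 32 ∧
      ‖c' - c‖ + ε * ψ (ratHeight v) / 2 ≤ r ∧
      ∀ x, ‖x - c'‖ ≤ ε * ψ (ratHeight v) / 2 → ‖x - ratPoint v‖ < ψ (ratHeight v) ∧
        ∀ w, A < (ratHeight w : ℝ) ^ (n + 1) * r ^ n →
          (ratHeight w : ℝ) ^ (n + 1) * ψ (ratHeight v) ^ n < A →
          (1 - 6 * ε) * ψ (ratHeight w) ≤ ‖x - ratPoint w‖ := by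
  have hrr : r / 2 ≤ r := by linarith
  obtain ⟨v, ⟨hvc, hvQ⟩, hvmax⟩ := Set.exists_max_image _
    (fun w => ψ (ratHeight w) - ε * ‖ratPoint w - ratPoint v₀‖)
    (finite_ratPoint_of_height_le c r Q) ⟨v₀, hv₀.trans hrr, hv₀Q⟩
  have hvA := hc v hvc
  set ρ := ψ (ratHeight v) with hρ
  have hρ0 : 0 < ρ := hpos _
  have hε8R : ε / (8 * R) ≤ ε / 32 := by
    apply div_le_div_of_nonneg_left hε.le (by norm_num); linarith
  have hρr : ρ ≤ ε / 32 * r :=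
    (hsm r hr le_rfl _ hvA.le).trans (by gcongr)
  have hvv₀ : ‖ratPoint v - ratPoint v₀‖ ≤ r / 32 := by
    have h1 := hvmax v₀ ⟨hv₀.trans hrr, hv₀Q⟩
    have h2 := hpos (ratHeight v₀)
    simp only [sub_self, norm_zero, mul_zero, sub_zero] at h1
    have h3 : ε * ‖ratPoint v - ratPoint v₀‖ ≤ ε * (r / 32) := by linarith
    exact le_of_mul_le_mul_left h3 hε
  have hvc' : ‖ratPoint v - c‖ ≤ 17 / 32 * r := by
    have := norm_sub_le_norm_sub_add_norm_sub (ratPoint v) (ratPoint v₀) c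
    linarith
  have hρr' : ρ ≤ r / 32 := by nlinarith
  have hvρ : (ratHeight v : ℝ) ^ (n + 1) * ρ ^ n < A := by
    by_contra! h
    have h1 := hsm ρ hρ0 (by linarith) _ h
    have h2 : ε / (8 * R) < 1 := by linarith
    nlinarith
  obtain ⟨a, b, ha, hab⟩ := exists_hyperplane_of_small_height hn (ratPoint v) (t := 4 * ρ)
    (by positivity)
    {w | ‖ratPoint w - ratPoint v‖ ≤ 4 * ρ ∧ (ratHeight w : ℝ) ^ (n + 1) * ρ ^ n < A}
    (fun w hw => hw.1) (fun w hw => by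
      have h1 : (4 * ρ) ^ n ≤ (2 * R) ^ n * ρ ^ n := by
        rw [← mul_pow]; gcongr; linarith
      have h2 : ((n + 1).factorial * (2 * R) ^ n : ℝ) * A = 1 / 2 := by
        rw [hA]; field_simp
      have h3 : (0 : ℝ) < (n + 1).factorial * (2 * R) ^ n := by positivity
      calc (n + 1).factorial * (4 * ρ) ^ n * (ratHeight w : ℝ) ^ (n + 1)
          ≤ (n + 1).factorial * ((2 * R) ^ n * ρ ^ n) * (ratHeight w : ℝ) ^ (n + 1) := by gcongr
        _ = (n + 1).factorial * (2 * R) ^ n * ((ratHeight w : ℝ) ^ (n + 1) * ρ ^ n) := by ring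
        _ ≤ (n + 1).factorial * (2 * R) ^ n * A := by gcongr; exact hw.2.le
        _ < 1 := by rw [h2]; norm_num)
  have hvb : ∑ i, a i * ratPoint v i = b :=
    hab v ⟨by simp only [sub_self, norm_zero]; positivity, hvρ⟩
  obtain ⟨σ, hσa, hσ1⟩ := exists_signs a
  have hd0 : 0 ≤ (1 - ε) * ρ := mul_nonneg (by linarith) hρ0.le
  set c' : Fin n → ℝ := fun i => ratPoint v i + (1 - ε) * ρ * σ i with hc'
  have hc'v : ‖c' - ratPoint v‖ ≤ (1 - ε) * ρ := by
    rw [pi_norm_le_iff_of_nonneg hd0]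
    intro i
    simp only [hc', Pi.sub_apply, add_sub_cancel_left, Real.norm_eq_abs]
    rw [abs_mul, hσ1, mul_one, abs_of_nonneg hd0]
  have hc'b : (1 - ε) * ρ * ∑ i, |a i| ≤ |∑ i, a i * c' i - b| := by
    have h2 : ∑ i, a i * c' i - b = (1 - ε) * ρ * ∑ i, |a i| := by
      simp only [hc', mul_add (a _), Finset.sum_add_distrib, hvb, add_sub_cancel_left,
        Finset.mul_sum]
      refine Finset.sum_congr rfl fun i _ => ?_
      rw [← hσa]; ring
    rw [h2]; exact le_abs_self _
  refine ⟨v, c', hvQ, hvA, hρr', ?_, fun x hx => ?_⟩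
  · have := norm_sub_le_norm_sub_add_norm_sub c' (ratPoint v) c
    nlinarith
  · have hxv : ‖x - ratPoint v‖ < ρ := by
      have := norm_sub_le_norm_sub_add_norm_sub x c' (ratPoint v)
      nlinarith
    refine ⟨hxv, fun w hwr hwρ => ?_⟩
    have hψw := hpos (ratHeight w)
    have hψw1 : (1 - 6 * ε) * ψ (ratHeight w) ≤ ψ (ratHeight w) := by nlinarith
    by_cases hwc : ‖ratPoint w - c‖ ≤ r
    · have hmax : ψ (ratHeight w) ≤ ρ + ε * ‖ratPoint w - ratPoint v‖ := by
        by_cases hwQ : ratHeight w ≤ Q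
        · have h1 := hvmax w ⟨hwc, hwQ⟩
          have h2 := norm_sub_le_norm_sub_add_norm_sub (ratPoint w) (ratPoint v) (ratPoint v₀)
          nlinarith
        · have h1 : ψ (ratHeight w) ≤ ρ := hanti (by omega)
          have h2 : 0 ≤ ε * ‖ratPoint w - ratPoint v‖ := by positivity
          linarith
      by_cases hwv : ‖ratPoint w - ratPoint v‖ ≤ 4 * ρ
      · have h1 := le_norm_sub_of_hyperplane ha (hab w ⟨hwv, hwρ⟩) hc'b hx
        have h2 : ψ (ratHeight w) ≤ (1 + 4 * ε) * ρ := by nlinarith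
        have h3 : (1 - 6 * ε) * ψ (ratHeight w) ≤ (1 - 6 * ε) * ((1 + 4 * ε) * ρ) := by
          gcongr; linarith
        nlinarith [mul_pos (mul_pos hε hε) hρ0, mul_pos hε hρ0]
      · have h1 := norm_sub_le_norm_sub_add_norm_sub (ratPoint w) x (ratPoint v)
        rw [norm_sub_rev (ratPoint w) x] at h1
        have h2 : ε * ‖ratPoint w - ratPoint v‖ ≤ 1 / 8 * ‖ratPoint w - ratPoint v‖ := by gcongr
        linarith
    · have h1 := hsm r hr le_rfl _ hwr.le
      have h2 : ε / (8 * R) * r ≤ 1 / 256 * r := mul_le_mul_of_nonneg_right (by linarith) hr.le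
      have h3 := norm_sub_le_norm_sub_add_norm_sub (ratPoint w) x c
      have h4 := norm_sub_le_norm_sub_add_norm_sub x (ratPoint v) c
      rw [norm_sub_rev (ratPoint w) x] at h3
      linarith

/-- Dirichlet's theorem on simultaneous approximation. -/
lemma exists_simultaneous_approx {n : ℕ} (c : Fin n → ℝ) {L : ℕ} (hL : 1 ≤ L) :
    ∃ (q : ℕ) (p : Fin n → ℤ), 1 ≤ q ∧ q ≤ L ^ n ∧ ∀ i, |q * c i - p i| * L ≤ 1 := by
  have hL0 : (0 : ℝ) < L := by exact_mod_cast hL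
  set box : ℕ → Fin n → ℤ := fun k i => ⌊Int.fract (k * c i) * L⌋ with hbox
  have hmaps : ∀ k ∈ Finset.range (L ^ n + 1),
      box k ∈ Fintype.piFinset fun _ : Fin n => Finset.Ico (0 : ℤ) L := fun k _ => by
    rw [Fintype.mem_piFinset]
    intro i
    have h0 := Int.fract_nonneg (k * c i)
    have h1 := Int.fract_lt_one (k * c i)
    rw [Finset.mem_Ico]
    refine ⟨Int.floor_nonneg.2 (by positivity), Int.floor_lt.2 ?_⟩
    push_cast
    nlinarith
  obtain ⟨k, hk, l, hl, hkl, heq⟩ := Finset.exists_ne_map_eq_of_card_lt_of_maps_to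
    (by simp) hmaps
  wlog hlt : l < k generalizing k l
  · exact this l hl k hk hkl.symm heq.symm (by omega)
  refine ⟨k - l, fun i => ⌊k * c i⌋ - ⌊l * c i⌋, by omega, ?_, fun i => ?_⟩
  · have := Finset.mem_range.1 hk
    omega
  · have h1 := congrFun heq i
    simp only [hbox] at h1
    have h2 := Int.abs_sub_lt_one_of_floor_eq_floor h1
    rw [← sub_mul, abs_mul, Nat.abs_cast] at h2
    rw [Nat.cast_sub hlt.le]
    have h3 : ((k : ℝ) - l) * c i - ((⌊(k : ℝ) * c i⌋ - ⌊(l : ℝ) * c i⌋ : ℤ) : ℝ) =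
        Int.fract (k * c i) - Int.fract (l * c i) := by
      simp only [Int.fract]; push_cast; ring
    rw [h3]; exact h2.le

lemma exists_ratPoint_approx {n : ℕ} (c : Fin n → ℝ) {L : ℕ} (hL : 1 ≤ L) :
    ∃ v : Fin n → ℚ, ratHeight v ≤ L ^ n ∧ ‖ratPoint v - c‖ * (ratHeight v * L) ≤ 1 := by
  obtain ⟨q, p, hq, hqL, h⟩ := exists_simultaneous_approx c hL
  have hq0 : (0 : ℝ) < q := by exact_mod_cast hq
  have hL0 : (0 : ℝ) < L := by exact_mod_cast hL
  have hle := ratHeight_le_of_int (fun i => (p i : ℚ) / q) hq p fun i => rfl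
  refine ⟨fun i => p i / q, hle.trans hqL, ?_⟩
  have h1 : ‖ratPoint (fun i => (p i : ℚ) / q) - c‖ ≤ 1 / (q * L) := by
    rw [pi_norm_le_iff_of_nonneg (by positivity)]
    intro i
    have h2 := h i
    have h3 : (ratPoint (fun i => (p i : ℚ) / q) - c) i = -((q * c i - p i) / q) := by
      simp only [ratPoint, Pi.sub_apply]; push_cast; field_simp; ring
    rw [h3, norm_neg, Real.norm_eq_abs, abs_div, abs_of_pos hq0, div_le_div_iff₀ hq0 (by positivity)]
    nlinarith
  calc _ ≤ 1 / (q * L : ℝ) * (q * L) := by gcongr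
    _ = 1 := by field_simp

/-- A cube in the construction, with `gap` the distance kept from all rationals treated before the
current stage. -/
structure CubeNode (n : ℕ) where
  center : Fin n → ℝ
  radius : ℝ
  gap : ℝ
  stage : ℕ
  depth : ℕ

/-- The relative precision used at a given stage. -/
noncomputable def stageTol (k : ℕ) : ℝ := 1 / (8 * (k + 1))

lemma stageTol_pos (k : ℕ) : 0 < stageTol k := by unfold stageTol; positivity

lemma stageTol_le (k : ℕ) : stageTol k ≤ 1 / 8 := by
  unfold stageTol
  have : (0 : ℝ) ≤ k := Nat.cast_nonneg k
  apply div_le_div_of_nonneg_left <;> linarith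

/-- `ψ` is smaller than `δ * t` at all heights at least of order `t ^ (-n / (n + 1))`, for all
scales `t ≤ r`. -/
def SmallBelow (n : ℕ) (ψ : ℕ → ℝ) (A δ r : ℝ) : Prop :=
  ∀ t, 0 < t → t ≤ r → ∀ H : ℕ, A ≤ (H : ℝ) ^ (n + 1) * t ^ n → ψ H ≤ δ * t

namespace CubeNode

variable {n : ℕ}

/-- The node is deep enough to pass to a new stage by approaching a rational point. -/
def Ready (ψ : ℕ → ℝ) (A R K s : ℝ) (N : ℕ) (S : CubeNode n) : Prop :=
  ∃ L : ℕ, K ≤ (L : ℝ) ^ (n + 1) * S.radius ∧ 1 < S.gap * L ∧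
    SmallBelow n ψ A (stageTol S.stage / (8 * R)) S.radius ∧
    ((N : ℝ) ^ S.depth)⁻¹ ≤ (stageTol S.stage * ψ (L ^ n) / (2 * R)) ^ s

/-- The invariants of the construction. -/
structure Valid (ψ : ℕ → ℝ) (A R s C : ℝ) (N : ℕ) (S : CubeNode n) : Prop where
  radius_pos : 0 < S.radius
  gap_pos : 0 < S.gap
  far : ∀ x, ‖x - S.center‖ ≤ S.radius → ∀ w, (ratHeight w : ℝ) ^ (n + 1) * S.radius ^ n ≤ A →
    S.gap ≤ ‖x - ratPoint w‖ ∨ A / R ^ n ≤ ‖x - ratPoint w‖ ^ n * (ratHeight w : ℝ) ^ (n + 1)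
  small : SmallBelow n ψ A (1 / R) S.radius
  mass : ((N : ℝ) ^ S.depth)⁻¹ ≤ C * S.radius ^ s

/-- The relation between a node and its children. -/
structure IsStep (ψ : ℕ → ℝ) (A R K s : ℝ) (N : ℕ) (S T : CubeNode n) : Prop where
  depth : T.depth = S.depth + 1
  subset : ‖T.center - S.center‖ + T.radius ≤ S.radius
  radius_le : T.radius ≤ S.radius / R
  far : ∀ x w, ‖x - T.center‖ ≤ T.radius → A < (ratHeight w : ℝ) ^ (n + 1) * S.radius ^ n →
    (ratHeight w : ℝ) ^ (n + 1) * T.radius ^ n ≤ A →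
    (1 - 6 * stageTol S.stage) * ψ (ratHeight w) ≤ ‖x - ratPoint w‖
  cases : (¬ S.Ready ψ A R K s N ∧ T.stage = S.stage ∧ T.radius = S.radius / R ∧ T.gap = S.gap) ∨
    (T.stage = S.stage + 1 ∧ ∃ v, A < (ratHeight v : ℝ) ^ (n + 1) * S.radius ^ n ∧
      ∀ x, ‖x - T.center‖ ≤ T.radius → ‖x - ratPoint v‖ < ψ (ratHeight v))

lemma Valid.height_gt {ψ : ℕ → ℝ} {A R s C : ℝ} {N : ℕ} {S : CubeNode n}
    (hS : S.Valid ψ A R s C N) (hn : 1 ≤ n) (hA : 0 < A) (hR : 0 < R) (w : Fin n → ℚ)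
    (hw : ‖ratPoint w - S.center‖ ≤ S.radius) :
    A < (ratHeight w : ℝ) ^ (n + 1) * S.radius ^ n := by
  by_contra! h
  have h1 := hS.gap_pos
  have h2 : 0 < A / R ^ n := by positivity
  rcases hS.far _ hw w h with h | h
  · simp only [sub_self, norm_zero] at h; linarith
  · simp only [sub_self, norm_zero, zero_pow (by omega : n ≠ 0), zero_mul] at h; linarith

lemma Valid.exists_ratPoint {ψ : ℕ → ℝ} {A R s C K : ℝ} {N : ℕ} {S : CubeNode n}
    (hS : S.Valid ψ A R s C N) (hn : 1 ≤ n) (hA : 0 < A) (hR : 0 < R)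
    (hK1 : 2 ≤ A / R ^ n * K) (hK2 : 2 ^ (n + 1) ≤ A * K) {L : ℕ}
    (hL : K ≤ (L : ℝ) ^ (n + 1) * S.radius) (hgap : 1 < S.gap * L) :
    ∃ v, ratHeight v ≤ L ^ n ∧ ‖ratPoint v - S.center‖ ≤ S.radius / 2 := by
  have hr := hS.radius_pos
  have hL1 : 1 ≤ L := by
    rcases Nat.eq_zero_or_pos L with rfl | h
    · norm_num at hgap
    · exact h
  have hL0 : (0 : ℝ) < L := by exact_mod_cast hL1
  obtain ⟨v, hv, hvc⟩ := exists_ratPoint_approx S.center hL1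
  have hH : (1 : ℝ) ≤ ratHeight v := by exact_mod_cast ratHeight_pos v
  set D := ‖ratPoint v - S.center‖ with hD
  set H := (ratHeight v : ℝ) with hHdef
  have hD0 : 0 ≤ D := norm_nonneg _
  have hDL : D * L ≤ 1 := by nlinarith [mul_nonneg hD0 hL0.le]
  have hB : 0 < A / R ^ n := by positivity
  have hlow : A < H ^ (n + 1) * S.radius ^ n := by
    by_contra! h
    refine (lt_irrefl A) (lt_of_lt_of_le (hS.height_gt hn hA hR v ?_) h)
    rcases hS.far S.center (by simpa using hr.le) v h with h1 | h1
    · rw [norm_sub_rev] at h1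
      nlinarith
    · rw [norm_sub_rev] at h1
      have h2 : A / R ^ n * L ^ n ≤ H := by
        calc A / R ^ n * L ^ n ≤ D ^ n * H ^ (n + 1) * L ^ n := by gcongr
          _ = (D * L) ^ n * H ^ (n + 1) := by rw [mul_pow]; ring
          _ = (D * (H * L)) ^ n * H := by simp only [mul_pow]; ring
          _ ≤ 1 ^ n * H := by gcongr
          _ = H := by simp
      have h3 : D * (A / R ^ n * L ^ n * L) ≤ 1 := le_trans (by gcongr) hvc
      have h4 : D * (A / R ^ n * K) ≤ S.radius := by
        calc D * (A / R ^ n * K) ≤ D * (A / R ^ n * ((L : ℝ) ^ (n + 1) * S.radius)) := by gcongr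
          _ = D * (A / R ^ n * L ^ n * L) * S.radius := by ring
          _ ≤ 1 * S.radius := by gcongr
          _ = S.radius := one_mul _
      nlinarith
  refine ⟨v, hv, ?_⟩
  have h1 : (2 * D) ^ (n + 1) ≤ S.radius ^ (n + 1) := by
    have hLn : (0 : ℝ) < (L : ℝ) ^ (n + 1) := by positivity
    have h5 : (2 * D) ^ (n + 1) * (H ^ (n + 1) * L ^ (n + 1)) ≤
        S.radius ^ (n + 1) * (H ^ (n + 1) * L ^ (n + 1)) := by
      calc (2 * D) ^ (n + 1) * (H ^ (n + 1) * L ^ (n + 1))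
          = 2 ^ (n + 1) * (D * (H * L)) ^ (n + 1) := by simp only [mul_pow]; ring
        _ ≤ 2 ^ (n + 1) * 1 ^ (n + 1) := by gcongr
        _ ≤ A * K := by simpa using hK2
        _ ≤ H ^ (n + 1) * S.radius ^ n * ((L : ℝ) ^ (n + 1) * S.radius) := by
            gcongr
            by_contra! hK
            have : A * K < 0 := mul_neg_of_pos_of_neg hA hK
            have : (0 : ℝ) < 2 ^ (n + 1) := by positivity
            linarith
        _ = _ := by ring
    exact le_of_mul_le_mul_right h5 (by positivity)
  have h2 := le_of_pow_le_pow_left₀ (by omega) hr.le h1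
  linarith

theorem Valid.exists_children {ψ : ℕ → ℝ} {A R s C K : ℝ} {M N : ℕ} {S : CubeNode n}
    (hS : S.Valid ψ A R s C N) (hn : 1 ≤ n) (hpos : ∀ s, 0 < ψ s) (hanti : Antitone ψ)
    (hM : 1 ≤ M) (hR : R = 4 * M) (hA : A = 1 / (2 * (n + 1).factorial * (2 * R) ^ n))
    (hK1 : 2 ≤ A / R ^ n * K) (hK2 : 2 ^ (n + 1) ≤ A * K) (hs : 0 < s) (hN : R ^ s ≤ N)
    (hC : 1 ≤ C) :
    ∃ T : (Fin n → Fin M) → CubeNode n,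
      (∀ z, (T z).Valid ψ A R s C N ∧ S.IsStep ψ A R K s N (T z)) ∧
      ∀ z z', z ≠ z' → ∀ x y, ‖x - (T z).center‖ ≤ (T z).radius →
        ‖y - (T z').center‖ ≤ (T z').radius → (T z).radius ≤ ‖x - y‖ := by
  have hM' : (1 : ℝ) ≤ M := by exact_mod_cast hM
  have hR4 : 4 ≤ R := by linarith
  have hR0 : 0 < R := by linarith
  have hA0 : 0 < A := by rw [hA]; positivity
  have hr := hS.radius_pos
  have hN1 : (1 : ℝ) ≤ N := (Real.one_le_rpow (by linarith) hs.le).trans hN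
  have hε := stageTol_pos S.stage
  have hε8 := stageTol_le S.stage
  have hsep : ∀ {u : ℝ} {a b x y : Fin n → ℝ}, 3 * u ≤ ‖a - b‖ → ‖x - a‖ ≤ u → ‖y - b‖ ≤ u →
      u ≤ ‖x - y‖ := fun {u a b x y} h hx hy => by
    have h1 := norm_sub_le_norm_sub_add_norm_sub a x b
    have h2 := norm_sub_le_norm_sub_add_norm_sub x y b
    rw [norm_sub_rev a x] at h1
    linarith
  by_cases hready : S.Ready ψ A R K s N
  · obtain ⟨L, hLK, hLgap, hLsm, hLmass⟩ := hready
    obtain ⟨v₀, hv₀L, hv₀⟩ := hS.exists_ratPoint hn hA0 hR0 hK1 hK2 hLK hLgap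
    obtain ⟨v, c', hvL, hvA, hvr, hcc', hx⟩ := exists_exact_cube hn hpos hanti hR4 hA hε hε8 hr
      S.center (L ^ n) v₀ hv₀ hv₀L (hS.height_gt hn hA0 hR0) hLsm
    set ε := stageTol S.stage with hεdef
    set ρ := ψ (ratHeight v) with hρ
    have hρ0 : 0 < ρ := hpos _
    set r' := ε * ρ / 2 with hr'
    have hr'0 : 0 < r' := by positivity
    obtain ⟨D, hDc, hDsep, hDfar⟩ := exists_subcubes hn hM hR hA c' hr'0
    set u := r' / R with hu
    have hu0 : 0 < u := by positivity
    have hr'r : r' ≤ S.radius := by linarith [norm_nonneg (c' - S.center)]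
    have hur : u ≤ S.radius / R := by rw [hu]; gcongr
    have hur' : u ≤ S.radius := hur.trans (div_le_self hr.le (by linarith))
    have hxc' : ∀ z x, ‖x - D z‖ ≤ u → ‖x - c'‖ ≤ r' := fun z x hxz => by
      have := norm_sub_le_norm_sub_add_norm_sub x (D z) c'
      linarith [hDc z]
    refine ⟨fun z => ⟨D z, u, u, S.stage + 1, S.depth + 1⟩, fun z => ⟨⟨hu0, hu0, ?_, ?_, ?_⟩,
      ⟨rfl, ?_, hur, ?_, Or.inr ⟨rfl, v, hvA, ?_⟩⟩⟩, ?_⟩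
    · exact fun x hxz w hw => Or.inl (hDfar z x w hxz hw)
    · exact fun t ht htu => hS.small t ht (htu.trans hur')
    · have h1 : ε * ψ (L ^ n) / (2 * R) ≤ u := by
        have : ψ (L ^ n) ≤ ρ := hanti hvL
        rw [hu, hr', div_div]; gcongr
      have h2 : 0 < ψ (L ^ n) := hpos _
      calc ((N : ℝ) ^ (S.depth + 1))⁻¹ ≤ ((N : ℝ) ^ S.depth)⁻¹ := by
            gcongr
            omega
        _ ≤ (ε * ψ (L ^ n) / (2 * R)) ^ s := hLmass
        _ ≤ u ^ s := by gcongr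
        _ ≤ C * u ^ s := le_mul_of_one_le_left (by positivity) hC
    · have := norm_sub_le_norm_sub_add_norm_sub (D z) c' S.center
      have := hDc z
      simp only
      linarith
    · intro x w hxz hw1 hw2
      by_cases hw : (ratHeight w : ℝ) ^ (n + 1) * ρ ^ n < A
      · exact (hx x (hxc' z x hxz)).2 w hw1 hw
      · have h1 := hLsm ρ hρ0 (by linarith) _ (not_lt.1 hw)
        have h2 := hDfar z x w hxz hw2
        have h3 : ε / (8 * R) * ρ ≤ u := by
          have : u = 4 * (ε / (8 * R) * ρ) := by rw [hu, hr']; field_simp; norm_num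
          have : 0 < ε / (8 * R) * ρ := by positivity
          linarith
        have h4 := hpos (ratHeight w)
        nlinarith
    · exact fun x hxz => (hx x (hxc' z x hxz)).1
    · exact fun z z' hz x y hx hy => hsep (hDsep z z' hz) hx hy
  · obtain ⟨D, hDc, hDsep, hDfar⟩ := exists_subcubes hn hM hR hA S.center hr
    have hu0 : 0 < S.radius / R := by positivity
    have hur : S.radius / R ≤ S.radius := div_le_self hr.le (by linarith)
    have hxc : ∀ z x, ‖x - D z‖ ≤ S.radius / R → ‖x - S.center‖ ≤ S.radius := fun z x hxz => by
      have := norm_sub_le_norm_sub_add_norm_sub x (D z) S.center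
      linarith [hDc z]
    refine ⟨fun z => ⟨D z, S.radius / R, S.gap, S.stage, S.depth + 1⟩,
      fun z => ⟨⟨hu0, hS.gap_pos, ?_, ?_, ?_⟩,
      ⟨rfl, ?_, le_rfl, ?_, Or.inl ⟨hready, rfl, rfl, rfl⟩⟩⟩, ?_⟩
    · intro x hxz w hw
      by_cases hwr : (ratHeight w : ℝ) ^ (n + 1) * S.radius ^ n ≤ A
      · exact hS.far x (hxc z x hxz) w hwr
      · right
        have h1 := hDfar z x w hxz hw
        calc A / R ^ n ≤ (ratHeight w : ℝ) ^ (n + 1) * S.radius ^ n / R ^ n := by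
              gcongr; exact (not_le.1 hwr).le
          _ = (S.radius / R) ^ n * (ratHeight w : ℝ) ^ (n + 1) := by rw [div_pow]; ring
          _ ≤ _ := by gcongr
    · exact fun t ht htu => hS.small t ht (htu.trans hur)
    · calc ((N : ℝ) ^ (S.depth + 1))⁻¹ = ((N : ℝ) ^ S.depth)⁻¹ / N := by
            rw [pow_succ, mul_inv]; rfl
        _ ≤ C * S.radius ^ s / R ^ s := by
            have := hS.mass
            gcongr
        _ = C * (S.radius / R) ^ s := by rw [Real.div_rpow hr.le hR0.le]; ring
    · have := hDc z
      simp only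
      linarith
    · intro x w hxz hw1 hw2
      have h1 := hDfar z x w hxz hw2
      have h2 := hS.small S.radius hr le_rfl _ hw1.le
      have h3 := hpos (ratHeight w)
      have h4 : 1 / R * S.radius = S.radius / R := by ring
      nlinarith
    · exact fun z z' hz x y hx hy => hsep (hDsep z z' hz) hx hy

end CubeNode

lemma exists_smallBelow {n : ℕ} (hn : 1 ≤ n) {ψ : ℕ → ℝ} (hpos : ∀ s, 0 < ψ s)
    (hsmall : Tendsto (fun s : ℕ => (s : ℝ) ^ (((n : ℝ) + 1) / n) * ψ s) atTop (nhds 0))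
    {A δ : ℝ} (hA : 0 < A) (hδ : 0 < δ) : ∃ t₀, 0 < t₀ ∧ SmallBelow n ψ A δ t₀ := by
  have hn0 : (0 : ℝ) < n := by exact_mod_cast hn
  have h1 : Tendsto (fun s : ℕ => (s : ℝ) ^ (n + 1) * ψ s ^ n) atTop (nhds 0) := by
    have h := hsmall.pow n
    rw [zero_pow (by omega)] at h
    refine h.congr fun s => ?_
    rw [mul_pow, ← Real.rpow_natCast, ← Real.rpow_mul (Nat.cast_nonneg s),
      div_mul_cancel₀ _ hn0.ne', ← Nat.cast_succ, Real.rpow_natCast]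
  obtain ⟨H₀, hH₀⟩ := eventually_atTop.1 (h1.eventually (gt_mem_nhds (show 0 < δ ^ n * A by positivity)))
  obtain ⟨t₀, ht₀, hlt⟩ : ∃ t₀ : ℝ, 0 < t₀ ∧ (H₀ : ℝ) ^ (n + 1) * t₀ ^ n < A := by
    have h : Tendsto (fun t : ℝ => (H₀ : ℝ) ^ (n + 1) * t ^ n) (nhdsWithin 0 (Set.Ioi 0)) (nhds 0) := by
      have : Continuous fun t : ℝ => (H₀ : ℝ) ^ (n + 1) * t ^ n := by fun_prop
      have h := this.tendsto 0
      simp only [zero_pow (by omega : n ≠ 0), mul_zero] at h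
      exact h.mono_left nhdsWithin_le_nhds
    have := (h.eventually (gt_mem_nhds hA)).and self_mem_nhdsWithin
    obtain ⟨t, ht, ht'⟩ := this.exists
    exact ⟨t, ht', ht⟩
  refine ⟨t₀, ht₀, fun t ht htt H hH => ?_⟩
  have hHH : H₀ ≤ H := by
    by_contra! h
    have : (H : ℝ) ^ (n + 1) * t ^ n ≤ (H₀ : ℝ) ^ (n + 1) * t₀ ^ n := by gcongr
    linarith
  have h2 := hH₀ H hHH
  have hψ := hpos H
  have h3 : (ψ H) ^ n ≤ (δ * t) ^ n := by
    by_contra! h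
    have hH0 : (0 : ℝ) < (H : ℝ) ^ (n + 1) := by
      by_contra! h0
      nlinarith [pow_pos ht n]
    have h4 : δ ^ n * A ≤ (H : ℝ) ^ (n + 1) * ψ H ^ n := by
      calc δ ^ n * A ≤ δ ^ n * ((H : ℝ) ^ (n + 1) * t ^ n) := by gcongr
        _ = (H : ℝ) ^ (n + 1) * (δ * t) ^ n := by ring
        _ ≤ _ := by gcongr
    linarith
  exact le_of_pow_le_pow_left₀ (by omega) (by positivity) h3

lemma frequently_pow_of_frequently {n : ℕ} (hn : 1 ≤ n) {ψ : ℕ → ℝ} (hpos : ∀ s, 0 < ψ s)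
    (hanti : Antitone ψ) {s τ : ℝ} (hs : 0 < s) (hτ : 0 < τ)
    (hfreq : ∃ᶠ Q : ℕ in atTop, 1 ≤ ((Q : ℝ) ^ (n + 1)) ^ τ * ψ Q ^ s) :
    ∃ᶠ L : ℕ in atTop, 1 ≤ (((2 * (L : ℝ)) ^ n) ^ (n + 1)) ^ τ * ψ (L ^ n) ^ s := by
  rw [frequently_atTop] at hfreq ⊢
  intro a
  obtain ⟨Q, hQ, h⟩ := hfreq ((a + 1) ^ n)
  set x : ℝ := (Q : ℝ) ^ ((n : ℝ)⁻¹) with hx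
  have hxn : x ^ n = Q := Real.rpow_inv_natCast_pow (Nat.cast_nonneg Q) (by omega)
  have hx0 : 0 ≤ x := by positivity
  have hax : (a : ℝ) + 1 ≤ x := by
    refine le_of_pow_le_pow_left₀ (by omega : n ≠ 0) hx0 ?_
    rw [hxn]; exact_mod_cast hQ
  have hfl : (⌊x⌋₊ : ℝ) ≤ x := Nat.floor_le hx0
  have hfl2 := Nat.lt_floor_add_one x
  have ha : a + 1 ≤ ⌊x⌋₊ := Nat.le_floor (by push_cast; exact hax)
  have hL1 : (1 : ℝ) ≤ ⌊x⌋₊ := by exact_mod_cast (by omega : 1 ≤ ⌊x⌋₊)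
  refine ⟨⌊x⌋₊, by omega, h.trans ?_⟩
  have h1 : ψ Q ≤ ψ (⌊x⌋₊ ^ n) := by
    apply hanti
    have : (⌊x⌋₊ : ℝ) ^ n ≤ Q := by rw [← hxn]; gcongr
    exact_mod_cast this
  have h2 : (Q : ℝ) ≤ (2 * (⌊x⌋₊ : ℝ)) ^ n := by
    rw [← hxn]; gcongr; linarith
  have := hpos Q
  gcongr

lemma exists_ready_scale {n : ℕ} (hn : 1 ≤ n) {ψ : ℕ → ℝ} (hpos : ∀ s, 0 < ψ s)
    (hanti : Antitone ψ)
    (hsmall : Tendsto (fun s : ℕ => (s : ℝ) ^ (((n : ℝ) + 1) / n) * ψ s) atTop (nhds 0))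
    {s τ : ℝ} (hs : 0 < s) (hτ : 0 < τ)
    (hfreq : ∃ᶠ Q : ℕ in atTop, 1 ≤ ((Q : ℝ) ^ (n + 1)) ^ τ * ψ Q ^ s)
    {A R K : ℝ} {M N : ℕ} (hA : 0 < A) (hR : 1 < R) (hK : 0 < K) (hM : 1 ≤ M)
    (hRM : R ^ τ < M) (hN : N = M ^ n)
    {r g ε : ℝ} (hr : 0 < r) (hg : 0 < g) (hε : 0 < ε) (d : ℕ) :
    ∃ m L : ℕ, K ≤ (L : ℝ) ^ (n + 1) * (r / R ^ m) ∧ 1 < g * L ∧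
      SmallBelow n ψ A (ε / (8 * R)) (r / R ^ m) ∧
      ((N : ℝ) ^ (d + m))⁻¹ ≤ (ε * ψ (L ^ n) / (2 * R)) ^ s := by
  have hR0 : 0 < R := by linarith
  have hM0 : (0 : ℝ) < M := by exact_mod_cast hM
  obtain ⟨t₀, ht₀, hsm⟩ := exists_smallBelow hn hpos hsmall hA (show 0 < ε / (8 * R) by positivity)
  set c₀ : ℝ := (2 ^ (n + 1) * (R * K / r)) ^ n with hc₀
  have hc₀0 : 0 < c₀ := by positivity
  set e : ℝ := (ε / (2 * R)) ^ s with he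
  have he0 : 0 < e := by positivity
  set b : ℝ := (M : ℝ) ^ n / (R ^ τ) ^ n with hb
  have hRτ : 0 < R ^ τ := by positivity
  have hb1 : 1 < b := by
    rw [hb, ← div_pow]
    exact one_lt_pow₀ ((one_lt_div hRτ).2 hRM) (by omega)
  have ev1 := (tendsto_pow_atTop_atTop_of_one_lt hb1).eventually_ge_atTop (c₀ ^ τ / e)
  have ev2 := (tendsto_pow_atTop_atTop_of_one_lt hR).eventually_ge_atTop (r / t₀)
  obtain ⟨m₁, hm₁⟩ := eventually_atTop.1 (ev1.and ev2)
  have ev3 : Tendsto (fun L : ℕ => (L : ℝ) ^ (n + 1) * (r / K)) atTop atTop :=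
    ((tendsto_pow_atTop (by omega)).comp tendsto_natCast_atTop_atTop).atTop_mul_const
      (by positivity)
  have ev4 : Tendsto (fun L : ℕ => g * (L : ℝ)) atTop atTop :=
    tendsto_natCast_atTop_atTop.const_mul_atTop hg
  obtain ⟨L, hLf, hL1, hL2⟩ := ((frequently_pow_of_frequently hn hpos hanti hs hτ hfreq).and_eventually
    ((ev3.eventually_ge_atTop (R ^ (m₁ + 1))).and (ev4.eventually_gt_atTop 1))).exists
  obtain ⟨m, hm1, hm2⟩ := exists_nat_pow_near ((one_le_pow₀ hR.le).trans hL1) hR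
  have hmm : m₁ ≤ m := by
    have := (pow_lt_pow_iff_right₀ hR).1 (hL1.trans_lt hm2)
    omega
  obtain ⟨h1, h2⟩ := hm₁ m hmm
  have hRm : 0 < R ^ m := by positivity
  refine ⟨m, L, ?_, hL2, ?_, ?_⟩
  · have : R ^ m * K ≤ (L : ℝ) ^ (n + 1) * r := by
      calc R ^ m * K ≤ (L : ℝ) ^ (n + 1) * (r / K) * K := by gcongr
        _ = _ := by field_simp
    rw [← mul_div_assoc, le_div_iff₀ hRm]; linarith
  · have h3 : r / R ^ m ≤ t₀ := by
      rw [div_le_iff₀ hRm]; rw [div_le_iff₀ ht₀] at h2; linarith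
    exact fun t ht htt => hsm t ht (htt.trans h3)
  · have hψ := hpos (L ^ n)
    have hψs : 0 < ψ (L ^ n) ^ s := by positivity
    have h3 : (((2 * (L : ℝ)) ^ n) ^ (n + 1)) ≤ c₀ * (R ^ n) ^ m := by
      have h4 : (L : ℝ) ^ (n + 1) ≤ R * K / r * R ^ m := by
        calc (L : ℝ) ^ (n + 1) = (L : ℝ) ^ (n + 1) * (r / K) * (K / r) := by field_simp
          _ ≤ R ^ (m + 1) * (K / r) := by gcongr
          _ = _ := by ring
      calc (((2 * (L : ℝ)) ^ n) ^ (n + 1)) = (2 ^ (n + 1) * (L : ℝ) ^ (n + 1)) ^ n := by ring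
        _ ≤ (2 ^ (n + 1) * (R * K / r * R ^ m)) ^ n := by gcongr
        _ = _ := by rw [hc₀, ← pow_mul R n m, mul_comm n m, pow_mul, ← mul_pow]; ring
    have h5 : (c₀ * (R ^ n) ^ m) ^ τ = c₀ ^ τ * ((R ^ τ) ^ n) ^ m := by
      rw [Real.mul_rpow hc₀0.le (by positivity), ← pow_mul, ← pow_mul, ← Real.rpow_natCast R,
        ← Real.rpow_natCast (R ^ τ), ← Real.rpow_mul hR0.le, ← Real.rpow_mul hR0.le, mul_comm τ]
    have h6 : c₀ ^ τ * ((R ^ τ) ^ n) ^ m ≤ (N : ℝ) ^ m * e := by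
      rw [div_le_iff₀ he0] at h1
      have hbm : b ^ m = (N : ℝ) ^ m / ((R ^ τ) ^ n) ^ m := by
        rw [hb, div_pow, hN]; push_cast; rfl
      rw [hbm, div_mul_eq_mul_div, le_div_iff₀ (by positivity)] at h1
      exact h1
    have hN1 : (1 : ℝ) ≤ N := by
      rw [hN]; exact_mod_cast Nat.one_le_pow _ _ hM
    have h7 : 1 ≤ (N : ℝ) ^ (d + m) * (e * ψ (L ^ n) ^ s) := by
      calc 1 ≤ _ := hLf
        _ ≤ (c₀ * (R ^ n) ^ m) ^ τ * ψ (L ^ n) ^ s := by gcongr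
        _ ≤ (N : ℝ) ^ m * e * ψ (L ^ n) ^ s := by rw [h5]; gcongr
        _ = (N : ℝ) ^ m * (e * ψ (L ^ n) ^ s) := by ring
        _ ≤ _ := by gcongr; omega
    have h8 : (ε * ψ (L ^ n) / (2 * R)) ^ s = e * ψ (L ^ n) ^ s := by
      rw [he, ← Real.mul_rpow (by positivity) hψ.le]; ring_nf
    rw [h8, inv_le_iff_one_le_mul₀' (by positivity)]
    exact h7

namespace CubeNode

/-- An infinite branch of the construction. -/
structure IsBranch {n : ℕ} (ψ : ℕ → ℝ) (A R K s C : ℝ) (N : ℕ) (S : ℕ → CubeNode n) : Prop where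
  valid : ∀ j, (S j).Valid ψ A R s C N
  step : ∀ j, (S j).IsStep ψ A R K s N (S (j + 1))

variable {n : ℕ} {ψ : ℕ → ℝ} {A R K s C τ : ℝ} {M N : ℕ} {S : ℕ → CubeNode n}

lemma IsBranch.depth_eq (hS : IsBranch ψ A R K s C N S) (i : ℕ) :
    (S i).depth = (S 0).depth + i := by
  induction i with
  | zero => rfl
  | succ i ih => rw [(hS.step i).depth, ih, add_assoc]

lemma IsBranch.radius_anti (hS : IsBranch ψ A R K s C N S) :
    Antitone fun j => (S j).radius :=
  antitone_nat_of_succ_le fun j => by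
    have := (hS.step j).subset
    linarith [norm_nonneg ((S (j + 1)).center - (S j).center)]

lemma IsBranch.radius_le (hS : IsBranch ψ A R K s C N S) (hR : 0 < R) (j : ℕ) :
    (S j).radius ≤ (S 0).radius / R ^ j := by
  induction j with
  | zero => simp
  | succ j ih =>
    refine (hS.step j).radius_le.trans ?_
    rw [pow_succ, ← div_div]
    gcongr

lemma IsBranch.tendsto_radius (hS : IsBranch ψ A R K s C N S) (hR : 1 < R) :
    Tendsto (fun j => (S j).radius) atTop (nhds 0) := by
  refine squeeze_zero (fun j => (hS.valid j).radius_pos.le)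
    (fun j => hS.radius_le (by linarith) j) ?_
  exact tendsto_const_nhds.div_atTop (tendsto_pow_atTop_atTop_of_one_lt hR)

lemma IsBranch.exists_height_le (hS : IsBranch ψ A R K s C N S) (hn : 1 ≤ n) (hA : 0 < A)
    (hR : 1 < R) (H : ℕ) : ∃ j, (H : ℝ) ^ (n + 1) * (S j).radius ^ n ≤ A := by
  have h := ((hS.tendsto_radius hR).pow n).const_mul ((H : ℝ) ^ (n + 1))
  rw [zero_pow (by omega), mul_zero] at h
  obtain ⟨j, hj⟩ := (h.eventually (gt_mem_nhds hA)).exists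
  exact ⟨j, hj.le⟩

lemma IsBranch.stage_mono (hS : IsBranch ψ A R K s C N S) : Monotone fun j => (S j).stage :=
  monotone_nat_of_le_succ fun j => by
    rcases (hS.step j).cases with h | h
    · exact h.2.1.ge
    · rw [h.1]; omega

lemma IsBranch.exists_stage_succ (hS : IsBranch ψ A R K s C N S) (hn : 1 ≤ n)
    (hpos : ∀ s, 0 < ψ s) (hanti : Antitone ψ)
    (hsmall : Tendsto (fun s : ℕ => (s : ℝ) ^ (((n : ℝ) + 1) / n) * ψ s) atTop (nhds 0))
    (hs : 0 < s) (hτ : 0 < τ) (hfreq : ∃ᶠ Q : ℕ in atTop, 1 ≤ ((Q : ℝ) ^ (n + 1)) ^ τ * ψ Q ^ s)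
    (hA : 0 < A) (hR : 1 < R) (hK : 0 < K) (hM : 1 ≤ M) (hRM : R ^ τ < M) (hN : N = M ^ n)
    (j : ℕ) : ∃ i, j ≤ i ∧ (S (i + 1)).stage = (S i).stage + 1 ∧
      ∃ v, A < (ratHeight v : ℝ) ^ (n + 1) * (S i).radius ^ n ∧
      ∀ x, ‖x - (S (i + 1)).center‖ ≤ (S (i + 1)).radius →
        ‖x - ratPoint v‖ < ψ (ratHeight v) := by
  by_contra! hcon
  have hc : ∀ i, j ≤ i → ¬ (S i).Ready ψ A R K s N ∧ (S (i + 1)).stage = (S i).stage ∧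
      (S (i + 1)).radius = (S i).radius / R ∧ (S (i + 1)).gap = (S i).gap := fun i hi => by
    rcases (hS.step i).cases with h | ⟨h1, v, h2, h3⟩
    · exact h
    · obtain ⟨x, hx1, hx2⟩ := hcon i hi h1 v h2
      exact absurd (h3 x hx1) (not_lt.2 hx2)
  have hconst : ∀ i, (S (j + i)).stage = (S j).stage ∧
      (S (j + i)).radius = (S j).radius / R ^ i ∧ (S (j + i)).gap = (S j).gap := fun i => by
    induction i with
    | zero => simp
    | succ i ih =>
      obtain ⟨-, h1, h2, h3⟩ := hc (j + i) (by omega)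
      rw [← add_assoc, h1, h2, h3, ih.1, ih.2.1, ih.2.2, div_div, pow_succ]
      exact ⟨rfl, rfl, rfl⟩
  obtain ⟨m, L, h1, h2, h3, h4⟩ := exists_ready_scale hn hpos hanti hsmall hs hτ hfreq hA hR hK hM
    hRM hN (hS.valid j).radius_pos (hS.valid j).gap_pos (stageTol_pos (S j).stage) (S j).depth
  refine (hc (j + m) (by omega)).1 ⟨L, ?_, ?_, ?_, ?_⟩
  · rwa [(hconst m).2.1]
  · rwa [(hconst m).2.2]
  · rwa [(hconst m).1, (hconst m).2.1]
  · rwa [(hconst m).1, hS.depth_eq, ← add_assoc, ← hS.depth_eq]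

lemma IsBranch.mem_Eapprox (hS : IsBranch ψ A R K s C N S) (hn : 1 ≤ n)
    (hpos : ∀ s, 0 < ψ s) (hanti : Antitone ψ)
    (hsmall : Tendsto (fun s : ℕ => (s : ℝ) ^ (((n : ℝ) + 1) / n) * ψ s) atTop (nhds 0))
    (hs : 0 < s) (hτ : 0 < τ) (hfreq : ∃ᶠ Q : ℕ in atTop, 1 ≤ ((Q : ℝ) ^ (n + 1)) ^ τ * ψ Q ^ s)
    (hA : 0 < A) (hR : 1 < R) (hK : 0 < K) (hM : 1 ≤ M) (hRM : R ^ τ < M) (hN : N = M ^ n)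
    {x : Fin n → ℝ} (hx : ∀ j, ‖x - (S j).center‖ ≤ (S j).radius) : x ∈ Eapprox n ψ := by
  have hstage := hS.exists_stage_succ hn hpos hanti hsmall hs hτ hfreq hA hR hK hM hRM hN
  constructor
  · change {v | ‖x - ratPoint v‖ < ψ (ratHeight v)}.Infinite
    intro hfin
    obtain ⟨H, hH⟩ := (hfin.image ratHeight).bddAbove
    obtain ⟨j, hj⟩ := hS.exists_height_le hn hA hR H
    obtain ⟨i, hji, -, v, hv1, hv2⟩ := hstage j
    have h1 : ratHeight v ≤ H := hH ⟨v, hv2 x (hx _), rfl⟩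
    have h2 : (S i).radius ≤ (S j).radius := hS.radius_anti hji
    have h3 : 0 < (S i).radius := (hS.valid i).radius_pos
    have h4 : (ratHeight v : ℝ) ^ (n + 1) * (S i).radius ^ n ≤
      (H : ℝ) ^ (n + 1) * (S j).radius ^ n := by gcongr
    linarith
  · simp only [Set.mem_iUnion, not_exists]
    rintro c ⟨hc0, hc1⟩
    change ¬ {v | ‖x - ratPoint v‖ < c * ψ (ratHeight v)}.Infinite
    rw [Set.not_infinite]
    have hunb : ∀ k, ∃ j, k ≤ (S j).stage := fun k => by
      induction k with
      | zero => exact ⟨0, Nat.zero_le _⟩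
      | succ k ih =>
        obtain ⟨j, hj⟩ := ih
        obtain ⟨i, hji, hi, -⟩ := hstage j
        have : (S j).stage ≤ (S i).stage := hS.stage_mono hji
        exact ⟨i + 1, by omega⟩
    obtain ⟨k, hk⟩ := exists_nat_gt (1 / (1 - c))
    obtain ⟨j₀, hj₀⟩ := hunb k
    have htol : ∀ j, j₀ ≤ j → c ≤ 1 - 6 * stageTol (S j).stage := fun j hj => by
      have h1 : (S j₀).stage ≤ (S j).stage := hS.stage_mono hj
      have h2 : (k : ℝ) ≤ (S j).stage := by exact_mod_cast hj₀.trans h1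
      have h3 : 0 < 1 - c := by linarith
      rw [div_lt_iff₀ h3] at hk
      have h4 : 6 * stageTol (S j).stage ≤ 1 - c := by
        unfold stageTol
        rw [mul_one_div, div_le_iff₀ (by positivity)]
        nlinarith
      linarith
    have hr := (hS.valid j₀).radius_pos
    refine (finite_ratPoint_of_height_le x (ψ 0) ⌊A / (S j₀).radius ^ n⌋₊).subset fun v hv => ?_
    rw [Set.mem_ofPred_eq] at hv ⊢
    have hψ0 : ψ (ratHeight v) ≤ ψ 0 := hanti (Nat.zero_le _)
    have hψ := hpos (ratHeight v)
    refine ⟨by rw [norm_sub_rev]; nlinarith, ?_⟩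
    by_cases hlow : (ratHeight v : ℝ) ^ (n + 1) * (S j₀).radius ^ n ≤ A
    · apply Nat.le_floor
      rw [le_div_iff₀ (by positivity)]
      have : (1 : ℝ) ≤ ratHeight v := by exact_mod_cast ratHeight_pos v
      have : (ratHeight v : ℝ) ≤ (ratHeight v : ℝ) ^ (n + 1) := le_self_pow₀ this (by omega)
      exact le_trans (by gcongr) hlow
    · exfalso
      classical
      have hex := hS.exists_height_le hn hA hR (ratHeight v)
      have hspec := Nat.find_spec hex
      set j := Nat.find hex with hj
      have hjj : j₀ < j := by
        by_contra! h
        have h2 : (S j₀).radius ≤ (S j).radius := hS.radius_anti h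
        exact hlow (le_trans (by gcongr) hspec)
      obtain ⟨i, hi⟩ : ∃ i, j = i + 1 := ⟨j - 1, by omega⟩
      have hmin := Nat.find_min hex (show i < Nat.find hex by omega)
      have h1 := (hS.step i).far x v (hx _) (not_le.1 hmin) (by rw [hi] at hspec; exact hspec)
      have h2 := htol i (by omega)
      nlinarith

end CubeNode

/-- A metric tree of sets, indexed by digit sequences, whose diameters decay slowly compared with
the number of pieces has large Hausdorff dimension. -/
lemma le_dimH_of_separated {X : Type*} [MetricSpace X] {N : ℕ} (hN : 1 < N) {E : Set X}
    (g : (ℕ → Fin N) → X) (hg : ∀ ω, g ω ∈ E) {s : NNReal} (hs : 0 < s) {C : ℝ} (hC : 0 ≤ C)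
    (hsep : ∀ ω ω' : ℕ → Fin N, ∀ j, (∀ i < j, ω i = ω' i) → ω j ≠ ω' j →
      0 < dist (g ω) (g ω') ∧ ((N : ℝ) ^ j)⁻¹ ≤ C * dist (g ω) (g ω') ^ (s : ℝ)) :
    (s : ENNReal) ≤ dimH E := by
  classical
  have hdiff : ∀ ω ω' : ℕ → Fin N, ω ≠ ω' → ∃ j, (∀ i < j, ω i = ω' i) ∧ ω j ≠ ω' j :=
    fun ω ω' h => by
      have hex := Function.ne_iff.1 h
      exact ⟨Nat.find hex, fun i hi => not_not.1 (Nat.find_min hex hi), Nat.find_spec hex⟩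
  have hinj : Function.Injective g := fun ω ω' h => by
    by_contra hne
    obtain ⟨j, h1, h2⟩ := hdiff ω ω' hne
    have := (hsep ω ω' j h1 h2).1
    rw [h, dist_self] at this
    exact lt_irrefl _ this
  have : Nonempty (ℕ → Fin N) := ⟨fun _ => ⟨0, by omega⟩⟩
  have hhol : HolderOnWith C.toNNReal s (Real.ofDigits ∘ Function.invFun g) (Set.range g) := by
    rintro _ ⟨ω, rfl⟩ _ ⟨ω', rfl⟩
    simp only [Function.comp, Function.leftInverse_invFun hinj _]
    by_cases hne : ω = ω'
    · simp [hne]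
    obtain ⟨j, h1, h2⟩ := hdiff ω ω' hne
    have h3 := (abs_ofDigits_sub_ofDigits_le h1).trans (hsep ω ω' j h1 h2).2
    rw [edist_dist, edist_dist, Real.dist_eq, ENNReal.ofReal_rpow_of_nonneg dist_nonneg s.coe_nonneg]
    change _ ≤ ENNReal.ofReal C * _
    rw [← ENNReal.ofReal_mul hC]
    exact ENNReal.ofReal_le_ofReal h3
  have h1 := hhol.dimH_image_le hs
  have h2 : Set.Icc (0 : ℝ) 1 ⊆ (Real.ofDigits ∘ Function.invFun g) '' Set.range g := fun t ht => by
    obtain ⟨ω, -, rfl⟩ := ofDigits_SurjOn hN ht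
    exact ⟨g ω, ⟨ω, rfl⟩, by simp [Function.leftInverse_invFun hinj _]⟩
  have h3 : dimH (Set.Icc (0 : ℝ) 1) = 1 := by
    rw [dimH_of_nonempty_interior (by simp)]; simp
  have h4 := (h3 ▸ dimH_mono h2).trans h1
  have hs0 : (s : ENNReal) ≠ 0 := by simpa using hs.ne'
  rw [ENNReal.le_div_iff_mul_le (Or.inl hs0) (Or.inl ENNReal.coe_ne_top), one_mul] at h4
  exact h4.trans (dimH_mono (Set.range_subset_iff.2 hg))

lemma exists_branching_number {τ : ℝ} (hτ1 : τ < 1) :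
    ∃ M : ℕ, 2 ≤ M ∧ (4 * (M : ℝ)) ^ τ < M := by
  have h := (tendsto_rpow_atTop (show 0 < 1 - τ by linarith)).comp
    (tendsto_natCast_atTop_atTop (R := ℝ))
  obtain ⟨M, h1, h2⟩ := ((h.eventually_gt_atTop ((4 : ℝ) ^ τ)).and (eventually_ge_atTop 2)).exists
  have hM : (0 : ℝ) < M := by exact_mod_cast (by omega : 0 < M)
  refine ⟨M, h2, ?_⟩
  rw [Real.mul_rpow (by norm_num) hM.le]
  calc (4 : ℝ) ^ τ * (M : ℝ) ^ τ < (M : ℝ) ^ (1 - τ) * (M : ℝ) ^ τ := by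
        gcongr; exact h1
    _ = M := by rw [← Real.rpow_add hM]; simp

lemma le_mul_of_frequently {n : ℕ} (hn : 1 ≤ n) {ψ : ℕ → ℝ} (hpos : ∀ s, 0 < ψ s)
    (hsmall : Tendsto (fun s : ℕ => (s : ℝ) ^ (((n : ℝ) + 1) / n) * ψ s) atTop (nhds 0))
    {s τ : ℝ} (hs : 0 < s)
    (hfreq : ∃ᶠ Q : ℕ in atTop, 1 ≤ ((Q : ℝ) ^ (n + 1)) ^ τ * ψ Q ^ s) : s ≤ n * τ := by
  have hn0 : (0 : ℝ) < n := by exact_mod_cast hn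
  obtain ⟨Q, hQ, h1, h2⟩ := (hfreq.and_eventually
    ((hsmall.eventually (gt_mem_nhds one_pos)).and (eventually_ge_atTop 2))).exists
  have hQ1 : (1 : ℝ) < Q := by exact_mod_cast (by omega : 1 < Q)
  have hQ0 : (0 : ℝ) < Q := by linarith
  have hψ := hpos Q
  by_contra! h
  have h3 : ψ Q ≤ (Q : ℝ) ^ (-(((n : ℝ) + 1) / n)) := by
    rw [Real.rpow_neg hQ0.le, ← one_div, le_div_iff₀ (by positivity)]
    linarith
  have h4 : ((Q : ℝ) ^ (n + 1)) ^ τ * ψ Q ^ s ≤ (Q : ℝ) ^ ((n + 1) * τ - (n + 1) / n * s) := by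
    calc ((Q : ℝ) ^ (n + 1)) ^ τ * ψ Q ^ s
        ≤ ((Q : ℝ) ^ (n + 1)) ^ τ * ((Q : ℝ) ^ (-(((n : ℝ) + 1) / n))) ^ s := by gcongr
      _ = _ := by
        rw [← Real.rpow_natCast, ← Real.rpow_mul hQ0.le, ← Real.rpow_mul hQ0.le,
          ← Real.rpow_add hQ0]
        push_cast; ring_nf
  have h5 : (Q : ℝ) ^ (((n : ℝ) + 1) * τ - (n + 1) / n * s) < 1 := by
    apply Real.rpow_lt_one_of_one_lt_of_neg hQ1
    have : ((n : ℝ) + 1) * τ - (n + 1) / n * s = ((n : ℝ) + 1) / n * (n * τ - s) := by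
      field_simp
    rw [this]
    exact mul_neg_of_pos_of_neg (by positivity) (by linarith)
  linarith

open CubeNode in
theorem le_dimH_Eapprox {n : ℕ} (hn : 1 ≤ n) {ψ : ℕ → ℝ} (hpos : ∀ s, 0 < ψ s)
    (hanti : Antitone ψ)
    (hsmall : Tendsto (fun s : ℕ => (s : ℝ) ^ (((n : ℝ) + 1) / n) * ψ s) atTop (nhds 0))
    {s : NNReal} {τ : ℝ} (hs : 0 < s) (hτ : 0 < τ) (hτ1 : τ < 1)
    (hfreq : ∃ᶠ Q : ℕ in atTop, 1 ≤ ((Q : ℝ) ^ (n + 1)) ^ τ * ψ Q ^ (s : ℝ)) :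
    (s : ENNReal) ≤ dimH (Eapprox n ψ) := by
  have hs' : (0 : ℝ) < s := hs
  have hsτ := le_mul_of_frequently hn hpos hsmall hs' hfreq
  obtain ⟨M, hM2, hRM⟩ := exists_branching_number hτ1
  have hM : 1 ≤ M := by omega
  have hM' : (2 : ℝ) ≤ M := by exact_mod_cast hM2
  set R : ℝ := 4 * M with hR
  have hR1 : 1 < R := by linarith
  have hR0 : 0 < R := by linarith
  have hN : R ^ (s : ℝ) ≤ (M ^ n : ℕ) := by
    calc R ^ (s : ℝ) ≤ R ^ ((n : ℝ) * τ) := Real.rpow_le_rpow_of_exponent_le hR1.le hsτ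
      _ = (R ^ τ) ^ n := by rw [mul_comm, Real.rpow_mul hR0.le, Real.rpow_natCast]
      _ ≤ (M : ℝ) ^ n := by gcongr
      _ = _ := by push_cast; rfl
  set A : ℝ := 1 / (2 * (n + 1).factorial * (2 * R) ^ n) with hA
  have hA0 : 0 < A := by positivity
  set K : ℝ := max (2 / (A / R ^ n)) (2 ^ (n + 1) / A) with hK
  have hK0 : 0 < K := lt_max_of_lt_left (by positivity)
  have hK1 : 2 ≤ A / R ^ n * K := by
    rw [← div_le_iff₀' (by positivity)]; exact le_max_left _ _
  have hK2 : 2 ^ (n + 1) ≤ A * K := by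
    rw [← div_le_iff₀' (by positivity)]; exact le_max_right _ _
  obtain ⟨t₀, ht₀, hsm⟩ := exists_smallBelow hn hpos hsmall hA0 (show 0 < 1 / R by positivity)
  obtain ⟨D, -, -, hD⟩ := exists_subcubes hn hM hR hA 0 (r := t₀ * R) (by positivity)
  rw [mul_div_cancel_right₀ _ hR0.ne'] at hD
  set C : ℝ := max 1 (t₀ ^ (s : ℝ))⁻¹ with hC
  have hC1 : 1 ≤ C := le_max_left _ _
  let z₀ : Fin n → Fin M := fun _ => ⟨0, by omega⟩
  let V := {S : CubeNode n // S.Valid ψ A R s C (M ^ n)}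
  let S₀ : V := ⟨⟨D z₀, t₀, t₀, 0, 0⟩, ht₀, ht₀, fun x hx w hw => Or.inl (hD z₀ x w hx hw), hsm, by
    have : 0 < t₀ ^ (s : ℝ) := by positivity
    rw [pow_zero, inv_one]
    calc 1 = (t₀ ^ (s : ℝ))⁻¹ * t₀ ^ (s : ℝ) := (inv_mul_cancel₀ this.ne').symm
      _ ≤ C * t₀ ^ (s : ℝ) := by gcongr; exact le_max_right _ _⟩
  have hch : ∀ S : V, ∃ T : (Fin n → Fin M) → V,
      (∀ z, S.1.IsStep ψ A R K s (M ^ n) (T z).1) ∧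
      ∀ z z', z ≠ z' → ∀ x y, ‖x - (T z).1.center‖ ≤ (T z).1.radius →
        ‖y - (T z').1.center‖ ≤ (T z').1.radius → (T z).1.radius ≤ ‖x - y‖ := fun S => by
    obtain ⟨T, h1, h2⟩ := S.2.exists_children hn hpos hanti hM hR hA hK1 hK2 hs' hN hC1
    exact ⟨fun z => ⟨T z, (h1 z).1⟩, fun z => (h1 z).2, h2⟩
  choose T hT1 hT2 using hch
  let node : (ℕ → Fin (M ^ n)) → ℕ → V := fun ω j =>
    Nat.rec S₀ (fun j S => T S (finFunctionFinEquiv.symm (ω j))) j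
  have hsucc : ∀ ω j, node ω (j + 1) = T (node ω j) (finFunctionFinEquiv.symm (ω j)) :=
    fun ω j => rfl
  have hbranch : ∀ ω, IsBranch ψ A R K s C (M ^ n) fun j => (node ω j).1 := fun ω =>
    ⟨fun j => (node ω j).2, fun j => hT1 (node ω j) _⟩
  have hdepth : ∀ ω j, (node ω j).1.depth = j := fun ω j =>
    ((hbranch ω).depth_eq j).trans (Nat.zero_add j)
  have hagree : ∀ ω ω' j, (∀ i < j, ω i = ω' i) → node ω j = node ω' j := fun ω ω' j => by
    induction j with
    | zero => exact fun _ => rfl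
    | succ j ih =>
      intro h
      rw [hsucc, hsucc, ih fun i hi => h i (by omega), h j (by omega)]
  have hlim : ∀ ω, ∃ x, ∀ j, ‖x - (node ω j).1.center‖ ≤ (node ω j).1.radius := fun ω => by
    obtain ⟨x, hx⟩ := IsCompact.nonempty_iInter_of_sequence_nonempty_isCompact_isClosed
      (fun j => Metric.closedBall (node ω j).1.center (node ω j).1.radius)
      (fun j => Metric.closedBall_subset_closedBall' (by
        have := ((hbranch ω).step j).subset
        rw [dist_eq_norm]; linarith))
      (fun j => Metric.nonempty_closedBall.2 (node ω j).2.radius_pos.le)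
      (isCompact_closedBall _ _) (fun j => Metric.isClosed_closedBall)
    exact ⟨x, fun j => by simpa [dist_eq_norm] using Set.mem_iInter.1 hx j⟩
  choose g hg using hlim
  refine le_dimH_of_separated (N := M ^ n) (Nat.one_lt_pow (by omega) hM2) g
    (fun ω => (hbranch ω).mem_Eapprox hn hpos hanti hsmall hs' hτ hfreq hA0 hR1 hK0 hM hRM rfl (hg ω))
    hs (C := (M ^ n : ℕ) * C) (by positivity) fun ω ω' j hj hne => ?_
  have hsep : (node ω (j + 1)).1.radius ≤ ‖g ω - g ω'‖ := by
    have h1 := hg ω (j + 1)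
    have h2 := hg ω' (j + 1)
    rw [hsucc] at h1 h2 ⊢
    rw [← hagree ω ω' j hj] at h2
    exact hT2 _ _ _ (fun h => hne (finFunctionFinEquiv.symm.injective h)) _ _ h1 h2
  have hr := (node ω (j + 1)).2.radius_pos
  rw [dist_eq_norm]
  refine ⟨hr.trans_le hsep, ?_⟩
  have hN0 : (0 : ℝ) < (M ^ n : ℕ) := by positivity
  calc (((M ^ n : ℕ) : ℝ) ^ j)⁻¹ = (M ^ n : ℕ) * (((M ^ n : ℕ) : ℝ) ^ (j + 1))⁻¹ := by
        rw [pow_succ]; field_simp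
    _ = (M ^ n : ℕ) * (((M ^ n : ℕ) : ℝ) ^ (node ω (j + 1)).1.depth)⁻¹ :=
        congrArg (fun k : ℕ => (M ^ n : ℕ) * (((M ^ n : ℕ) : ℝ) ^ k)⁻¹) (hdepth ω (j + 1)).symm
    _ ≤ (M ^ n : ℕ) * (C * (node ω (j + 1)).1.radius ^ (s : ℝ)) := by
        gcongr
        exact (node ω (j + 1)).2.mass
    _ ≤ (M ^ n : ℕ) * (C * ‖g ω - g ω'‖ ^ (s : ℝ)) := by gcongr
    _ = _ := by ring

lemma exists_cover_Wapprox {n : ℕ} {ψ : ℕ → ℝ} (hanti : Antitone ψ) {B : ℕ}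
    {m : ℝ} (hB : m + ψ 0 ≤ B) {x : Fin n → ℝ} (hx : x ∈ Wapprox n ψ) (hxm : ‖x‖ ≤ m) {Q : ℕ} :
    ∃ q : ℕ, ∃ p ∈ Fintype.piFinset fun _ : Fin n => Finset.Icc (-(B * (q + Q) : ℤ)) (B * (q + Q)),
      ‖x - fun i => (p i : ℝ) / (q + Q : ℕ)‖ ≤ ψ (q + Q) := by
  change {v | ‖x - ratPoint v‖ < ψ (ratHeight v)}.Infinite at hx
  obtain ⟨v, hv, hvQ⟩ : ∃ v, ‖x - ratPoint v‖ < ψ (ratHeight v) ∧ Q ≤ ratHeight v := by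
    by_contra! h
    refine hx ((finite_ratPoint_of_height_le x (ψ 0) Q).subset fun v hv => ⟨?_, (h v hv).le⟩)
    rw [norm_sub_rev]
    exact (lt_of_lt_of_le hv (hanti (Nat.zero_le _))).le
  obtain ⟨p, hp⟩ := exists_int_eq_ratHeight_mul v
  obtain ⟨q, hq⟩ := Nat.exists_eq_add_of_le' hvQ
  have hH : (0 : ℝ) < ratHeight v := by exact_mod_cast ratHeight_pos v
  refine ⟨q, p, ?_, ?_⟩
  · rw [Fintype.mem_piFinset]
    intro i
    have h1 : |ratPoint v i| ≤ B := by
      have h2 : ‖ratPoint v‖ ≤ m + ψ 0 := by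
        have h3 := norm_sub_norm_le (ratPoint v) x
        have h4 : ψ (ratHeight v) ≤ ψ 0 := hanti (Nat.zero_le _)
        rw [norm_sub_rev] at h3
        linarith
      exact (norm_le_pi_norm (ratPoint v) i).trans (h2.trans hB)
    have h5 : |(p i : ℝ)| ≤ B * ratHeight v := by
      rw [hp, abs_mul, Nat.abs_cast, mul_comm]; gcongr
    rw [hq] at h5
    rw [Finset.mem_Icc, ← abs_le]
    exact_mod_cast h5
  · have : (fun i => (p i : ℝ) / (q + Q : ℕ)) = ratPoint v := by
      funext i
      rw [← hq, hp]; field_simp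
    rw [this, ← hq]; exact hv.le

theorem dimH_Wapprox_le {n : ℕ} {ψ : ℕ → ℝ} (hpos : ∀ s, 0 < ψ s) (hanti : Antitone ψ)
    (hlim : Tendsto ψ atTop (nhds 0)) {s : NNReal} {δ : ℝ} (hδ : 0 < δ)
    (h : ∀ᶠ q : ℕ in atTop, ψ q ^ (s : ℝ) ≤ (q : ℝ) ^ (-((n : ℝ) + 1) - δ)) :
    dimH (Wapprox n ψ) ≤ s := by
  have hU : Wapprox n ψ = ⋃ m : ℕ, Wapprox n ψ ∩ Metric.closedBall 0 m := by
    rw [← Set.inter_iUnion, Metric.iUnion_closedBall_nat, Set.inter_univ]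
  rw [hU, dimH_iUnion]
  refine iSup_le fun m => ?_
  let _ : MeasurableSpace (Fin n → ℝ) := borel _
  have : BorelSpace (Fin n → ℝ) := ⟨rfl⟩
  apply dimH_le_of_hausdorffMeasure_ne_top
  obtain ⟨B, hB⟩ := exists_nat_ge ((m : ℝ) + ψ 0)
  let P : ℕ → Finset (Fin n → ℤ) := fun q =>
    Fintype.piFinset fun _ : Fin n => Finset.Icc (-(B * q : ℤ)) (B * q)
  let c : ℝ := (2 * B + 1) ^ n * 2 ^ (s : ℝ)
  let f : ℕ → ENNReal := fun q => ENNReal.ofReal (c * (q : ℝ) ^ (-1 - δ))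
  have hf : ∑' q, f q ≠ ⊤ := by
    apply Summable.tsum_ofReal_ne_top
    exact (Real.summable_nat_rpow.2 (by linarith)).mul_left c
  have hr : Tendsto (fun Q => ENNReal.ofReal (2 * ψ Q)) atTop (nhds 0) := by
    have := ENNReal.tendsto_ofReal (hlim.const_mul 2)
    simpa using this
  let t : (Q : ℕ) → (Σ q : ℕ, P (q + Q)) → Set (Fin n → ℝ) := fun Q a =>
    Metric.closedBall (fun i => (a.2.1 i : ℝ) / (a.1 + Q : ℕ)) (ψ (a.1 + Q))
  have hdiam : ∀ Q a, Metric.ediam (t Q a) ≤ ENNReal.ofReal (2 * ψ (a.1 + Q)) := fun Q a => by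
    refine Metric.ediam_le fun x hx y hy => ?_
    rw [edist_dist]
    apply ENNReal.ofReal_le_ofReal
    have := dist_triangle_right x y (fun i => (a.2.1 i : ℝ) / (a.1 + Q : ℕ))
    rw [Metric.mem_closedBall] at hx hy
    linarith
  have hmain := Measure.hausdorffMeasure_le_liminf_tsum (s : ℝ)
    (Wapprox n ψ ∩ Metric.closedBall 0 m) (l := atTop) (fun Q : ℕ => ENNReal.ofReal (2 * ψ Q)) hr t
    (Eventually.of_forall fun Q a => (hdiam Q a).trans (by
      apply ENNReal.ofReal_le_ofReal
      have := hanti (Nat.le_add_left Q a.1)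
      linarith))
    (Eventually.of_forall fun Q x hx => by
      have hxm : ‖x‖ ≤ m := by simpa using hx.2
      obtain ⟨q, p, hp, hxp⟩ := exists_cover_Wapprox hanti hB hx.1 hxm (Q := Q)
      refine Set.mem_iUnion.2 ⟨⟨q, p, ?_⟩, ?_⟩
      · simpa [P] using hp
      · rw [Metric.mem_closedBall, dist_eq_norm]; exact hxp)
  refine ne_top_of_le_ne_top hf (hmain.trans ?_)
  refine liminf_le_of_frequently_le' (Eventually.frequently ?_)
  obtain ⟨Q₀, hQ₀⟩ := eventually_atTop.1 h
  filter_upwards [eventually_ge_atTop Q₀, eventually_ge_atTop 1] with Q hQ hQ1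
  rw [ENNReal.tsum_sigma']
  refine le_trans (ENNReal.tsum_le_tsum fun q => ?_)
    (ENNReal.tsum_comp_le_tsum_of_injective (add_left_injective Q) f)
  have hq1 : (1 : ℝ) ≤ (q + Q : ℕ) := by exact_mod_cast (by omega : 1 ≤ q + Q)
  have hψ := hpos (q + Q)
  calc ∑' p : P (q + Q), Metric.ediam (t Q ⟨q, p⟩) ^ (s : ℝ)
      ≤ ∑' p : P (q + Q), ENNReal.ofReal ((2 * ψ (q + Q)) ^ (s : ℝ)) := by
        refine ENNReal.tsum_le_tsum fun p => ?_
        rw [← ENNReal.ofReal_rpow_of_nonneg (by positivity) s.coe_nonneg]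
        exact ENNReal.rpow_le_rpow (hdiam Q ⟨q, p⟩) s.coe_nonneg
    _ = ENNReal.ofReal ((P (q + Q)).card * (2 * ψ (q + Q)) ^ (s : ℝ)) := by
        rw [tsum_fintype, Finset.sum_const, nsmul_eq_mul, ENNReal.ofReal_mul (Nat.cast_nonneg _),
          ENNReal.ofReal_natCast, Finset.card_univ, Fintype.card_coe]
    _ ≤ f (q + Q) := by
        apply ENNReal.ofReal_le_ofReal
        have hcard : ((P (q + Q)).card : ℝ) ≤ (2 * B + 1) ^ n * ((q + Q : ℕ) : ℝ) ^ n := by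
          have h1 : (P (q + Q)).card = (2 * B * (q + Q) + 1) ^ n := by
            simp only [P, Fintype.card_piFinset, Int.card_Icc, Finset.prod_const, Finset.card_univ,
              Fintype.card_fin]
            congr 1
            have : (B * ((q + Q : ℕ) : ℤ) + 1 - -(B * ((q + Q : ℕ) : ℤ))) =
              ((2 * B * (q + Q) + 1 : ℕ) : ℤ) := by push_cast; ring
            rw [this, Int.toNat_natCast]
          rw [h1, ← mul_pow]
          push_cast at hq1 ⊢
          gcongr
          nlinarith
        have h2 := hQ₀ (q + Q) (by omega)
        rw [Real.mul_rpow (by norm_num) hψ.le]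
        calc ((P (q + Q)).card : ℝ) * (2 ^ (s : ℝ) * ψ (q + Q) ^ (s : ℝ))
            ≤ ((2 * B + 1) ^ n * ((q + Q : ℕ) : ℝ) ^ n) *
              (2 ^ (s : ℝ) * ((q + Q : ℕ) : ℝ) ^ (-((n : ℝ) + 1) - δ)) := by gcongr
          _ = c * (((q + Q : ℕ) : ℝ) ^ n * ((q + Q : ℕ) : ℝ) ^ (-((n : ℝ) + 1) - δ)) := by
            simp only [c]; ring
          _ = c * ((q + Q : ℕ) : ℝ) ^ (-1 - δ) := by
            rw [← Real.rpow_natCast, ← Real.rpow_add (by linarith)]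
            congr 2; ring

lemma tendsto_zero_of_tendsto_rpow_mul {n : ℕ} {ψ : ℕ → ℝ} (hpos : ∀ s, 0 < ψ s)
    (hsmall : Tendsto (fun s : ℕ => (s : ℝ) ^ (((n : ℝ) + 1) / n) * ψ s) atTop (nhds 0)) :
    Tendsto ψ atTop (nhds 0) := by
  refine squeeze_zero' (Eventually.of_forall fun q => (hpos q).le) ?_ hsmall
  filter_upwards [eventually_ge_atTop 1] with q hq
  have hq1 : (1 : ℝ) ≤ q := by exact_mod_cast hq
  exact le_mul_of_one_le_left (hpos q).le (Real.one_le_rpow hq1 (by positivity))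

lemma dimH_Wapprox_le_dimH_Eapprox {n : ℕ} (hn : 1 ≤ n) {ψ : ℕ → ℝ} (hpos : ∀ s, 0 < ψ s)
    (hanti : Antitone ψ)
    (hsmall : Tendsto (fun s : ℕ => (s : ℝ) ^ (((n : ℝ) + 1) / n) * ψ s) atTop (nhds 0)) :
    dimH (Wapprox n ψ) ≤ dimH (Eapprox n ψ) := by
  refine ENNReal.le_of_forall_nnreal_lt fun r hr => ?_
  rcases eq_or_ne r 0 with rfl | hr0
  · simp
  have hr0' : 0 < r := pos_iff_ne_zero.2 hr0
  have hrp : (0 : ℝ) < r := hr0'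
  by_contra hcon
  obtain ⟨r', hrr', hr'⟩ := ENNReal.lt_iff_exists_nnreal_btwn.1 hr
  have hrr : (r : ℝ) < r' := by exact_mod_cast hrr'
  have hr'0 : (0 : ℝ) < r' := hrp.trans hrr
  have hdiv : (r : ℝ) / r' < 1 := (div_lt_one hr'0).2 hrr
  have hdiv0 : 0 < (r : ℝ) / r' := by positivity
  set τ : ℝ := (r / r' + 1) / 2 with hτ
  have hτr : 1 < τ * (r' / r) := by
    have : r / r' < τ := by linarith
    calc (1 : ℝ) = r / r' * (r' / r) := by field_simp
      _ < _ := by gcongr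
  have hev : ¬ ∃ᶠ Q : ℕ in atTop, 1 ≤ ((Q : ℝ) ^ (n + 1)) ^ τ * ψ Q ^ (r : ℝ) := fun hf =>
    hcon (le_dimH_Eapprox hn hpos hanti hsmall hr0' (by linarith) (by linarith) hf)
  rw [not_frequently] at hev
  refine hr'.not_ge (dimH_Wapprox_le hpos hanti (tendsto_zero_of_tendsto_rpow_mul hpos hsmall)
    (δ := (n + 1) * (τ * (r' / r) - 1)) (mul_pos (by positivity) (by linarith)) ?_)
  filter_upwards [hev, eventually_ge_atTop 1] with q hq hq1
  have hq0 : (0 : ℝ) < q := by exact_mod_cast hq1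
  have hψ := hpos q
  have h1 : ψ q ^ (r : ℝ) ≤ (q : ℝ) ^ (-(((n : ℝ) + 1) * τ)) := by
    rw [Real.rpow_neg hq0.le, ← one_div, le_div_iff₀ (by positivity), Real.rpow_mul hq0.le,
      ← Nat.cast_succ, Real.rpow_natCast]
    rw [not_le, mul_comm] at hq
    exact hq.le
  calc ψ q ^ (r' : ℝ) = (ψ q ^ (r : ℝ)) ^ ((r' : ℝ) / r) := by
        rw [← Real.rpow_mul hψ.le]; congr 1; field_simp
    _ ≤ ((q : ℝ) ^ (-(((n : ℝ) + 1) * τ))) ^ ((r' : ℝ) / r) := by gcongr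
    _ = _ := by rw [← Real.rpow_mul hq0.le]; congr 1; ring

lemma eq_rpow_neg_log_div_log {x : ℝ} (hx : 0 < x) {q : ℕ} (hq : 2 ≤ q) :
    x = (q : ℝ) ^ (-(-Real.log x / Real.log q)) := by
  have hq1 : (1 : ℝ) < q := by exact_mod_cast hq
  have := Real.log_pos hq1
  rw [Real.rpow_def_of_pos (by linarith)]
  rw [show Real.log q * -(-Real.log x / Real.log q) = Real.log x by field_simp, Real.exp_log hx]

lemma eventually_le_lower_order {n : ℕ} {ψ : ℕ → ℝ} (hpos : ∀ s, 0 < ψ s)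
    (hsmall : Tendsto (fun s : ℕ => (s : ℝ) ^ (((n : ℝ) + 1) / n) * ψ s) atTop (nhds 0)) :
    ∀ᶠ q : ℕ in atTop, ((n : ℝ) + 1) / n ≤ -Real.log (ψ q) / Real.log q := by
  filter_upwards [hsmall.eventually (gt_mem_nhds one_pos), eventually_ge_atTop 2] with q h hq
  have hq1 : (1 : ℝ) < q := by exact_mod_cast hq
  have hlog := Real.log_pos hq1
  have h1 := Real.log_neg (mul_pos (by positivity) (hpos q)) h
  rw [Real.log_mul (by positivity) (hpos q).ne', Real.log_rpow (by linarith)] at h1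
  rw [le_div_iff₀ hlog]; linarith

/-- Main theorem: if `ψ` is non-increasing and `ψ(s) = o(s^{-(n+1)/n})`, then
`dim_H E(ψ) = dim_H W(ψ)`; in particular, when the lower order at infinity
`λ_ψ = liminf (-log ψ(s))/(log s)` is finite, `dim_H E(ψ) = (n+1)/λ_ψ`. -/
theorem exact_approx_dimension (n : ℕ) (hn : 1 ≤ n) (ψ : ℕ → ℝ)
    (hpos : ∀ s, 0 < ψ s) (hanti : Antitone ψ)
    (hsmall : Tendsto (fun s : ℕ => (s : ℝ) ^ (((n : ℝ) + 1) / n) * ψ s) atTop (nhds 0)) :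
    dimH (Eapprox n ψ) = dimH (Wapprox n ψ) ∧
      (IsBoundedUnder (· ≤ ·) atTop (fun s : ℕ => -Real.log (ψ s) / Real.log s) →
        dimH (Eapprox n ψ) = ENNReal.ofReal (((n : ℝ) + 1) /
          liminf (fun s : ℕ => -Real.log (ψ s) / Real.log s) atTop)) := by
  have heq : dimH (Eapprox n ψ) = dimH (Wapprox n ψ) :=
    le_antisymm (dimH_mono Set.sdiff_subset) (dimH_Wapprox_le_dimH_Eapprox hn hpos hanti hsmall)
  refine ⟨heq, fun hbdd => ?_⟩
  have hn0 : (0 : ℝ) < n := by exact_mod_cast hn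
  have hev := eventually_le_lower_order hpos hsmall
  have hbdd' : IsBoundedUnder (· ≥ ·) atTop fun s : ℕ => -Real.log (ψ s) / Real.log s :=
    isBoundedUnder_of_eventually_ge hev
  set lam := liminf (fun s : ℕ => -Real.log (ψ s) / Real.log s) atTop with hlam
  have hlam0 : 0 < lam :=
    lt_of_lt_of_le (by positivity) (le_liminf_of_le hbdd.isCoboundedUnder_ge hev)
  apply le_antisymm
  · rw [heq]
    by_contra! hcon
    obtain ⟨r, hr1, hr2⟩ := ENNReal.lt_iff_exists_nnreal_btwn.1 hcon
    have hr : ((n : ℝ) + 1) / lam < r := by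
      rw [← ENNReal.ofReal_coe_nnreal] at hr1
      exact (ENNReal.ofReal_lt_ofReal_iff_of_nonneg (by positivity)).1 hr1
    have hr0 : (0 : ℝ) < r := lt_trans (by positivity) hr
    have hlt : ((n : ℝ) + 1) / r < lam := by
      rw [div_lt_iff₀ hlam0] at hr; rw [div_lt_iff₀ hr0]; linarith
    obtain ⟨b, hb1, hb2⟩ := exists_between hlt
    rw [div_lt_iff₀ hr0] at hb1
    refine hr2.not_ge (dimH_Wapprox_le hpos hanti (tendsto_zero_of_tendsto_rpow_mul hpos hsmall)
      (δ := b * r - (n + 1)) (by linarith) ?_)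
    filter_upwards [eventually_lt_of_lt_liminf hb2 hbdd', eventually_ge_atTop 2] with q hq hq2
    have hq1 : (1 : ℝ) ≤ q := by exact_mod_cast (by omega : 1 ≤ q)
    rw [eq_rpow_neg_log_div_log (hpos q) hq2, ← Real.rpow_mul (by linarith)]
    apply Real.rpow_le_rpow_of_exponent_le hq1
    nlinarith
  · refine ENNReal.le_of_forall_nnreal_lt fun r hr1 => ?_
    rcases eq_or_ne r 0 with rfl | hr0
    · simp
    have hr0' : 0 < r := pos_iff_ne_zero.2 hr0
    have hrp : (0 : ℝ) < r := hr0'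
    have hr : (r : ℝ) < ((n : ℝ) + 1) / lam := by
      rw [← ENNReal.ofReal_coe_nnreal] at hr1
      exact (ENNReal.ofReal_lt_ofReal_iff_of_nonneg r.coe_nonneg).1 hr1
    have hlt : lam < ((n : ℝ) + 1) / r := by
      rw [lt_div_iff₀ hlam0] at hr; rw [lt_div_iff₀ hrp]; linarith
    obtain ⟨b, hb1, hb2⟩ := exists_between hlt
    rw [lt_div_iff₀ hrp] at hb2
    have hb0 : 0 < b := hlam0.trans hb1
    refine le_dimH_Eapprox hn hpos hanti hsmall hr0' (τ := b * r / (n + 1)) (by positivity)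
      ((div_lt_one (by positivity)).2 hb2) ?_
    refine ((frequently_lt_of_liminf_lt hbdd.isCoboundedUnder_ge hb1).and_eventually
      (eventually_ge_atTop 2)).mono fun q ⟨hq, hq2⟩ => ?_
    have hq1 : (1 : ℝ) ≤ q := by exact_mod_cast (by omega : 1 ≤ q)
    have hq0 : (0 : ℝ) < q := by linarith
    rw [eq_rpow_neg_log_div_log (hpos q) hq2, ← Real.rpow_mul hq0.le, ← Real.rpow_natCast,
      ← Real.rpow_mul hq0.le, ← Real.rpow_add hq0]
    apply Real.one_le_rpow hq1
    have h1 : ((n + 1 : ℕ) : ℝ) * (b * r / (n + 1)) = b * r := by push_cast; field_simp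
    rw [h1]
    nlinarith
end
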